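/- arXiv:2412.17071 — 4 statements merged into one kernel-verified Lean document; each statement's English description precedes it below -/
import Mathlib

section
/- Projection estimates (Lemma 3.4): Let Φ be a semiflow on X strongly focusing monotone with respect to the k-cone C, satisfying the standing assumptions, let Σ ⊆ E be a nonempty compact set of equilibria, and let Σ×(E_p), Σ×(F_p) be the bundles of a k-exponential separation along Σ associated with C, with Π^{E_p} the projection onto E_p along F_p and Π^{F_p} = I − Π^{E_p}. Then: (i) the operator norms of Π^{E_p} and Π^{F_p} are bounded uniformly over p ∈ Σ; (ii) there exists κ_Σ > 0 such that if v ∈ X∖{0} satisfies ‖Π^{E_p}v‖ ≥ κ_Σ‖Π^{F_p}v‖ for some p ∈ Σ, then v ∈ int C. -/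
open Set Metric Filter

/-- A semiflow on `X`: continuous on `[0,∞) × X`, `Φ₀ = id`, `Φ_{s+t} = Φ_s ∘ Φ_t`. -/
structure Semiflow (X : Type*) [NormedAddCommGroup X] [NormedSpace ℝ X] where
  toFun : ℝ → X → X
  cont : ContinuousOn (fun p : ℝ × X => toFun p.1 p.2) (Set.Ici (0:ℝ) ×ˢ Set.univ)
  map_zero : ∀ x, toFun 0 x = x
  map_add : ∀ s t : ℝ, 0 ≤ s → 0 ≤ t → ∀ x, toFun (s + t) x = toFun s (toFun t x)

section Defs

variable {X : Type*} [NormedAddCommGroup X] [NormedSpace ℝ X]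

/-- A cone of rank `k`: a closed set, stable under all real scalings, containing a
`k`-dimensional subspace and no subspace of higher dimension. -/
def IsKCone (C : Set X) (k : ℕ) : Prop :=
  IsClosed C ∧ (∀ (t : ℝ) (v : X), v ∈ C → t • v ∈ C) ∧
  (∃ W : Submodule ℝ X, (W : Set X) ⊆ C ∧ Module.rank ℝ W = k) ∧
  (∀ W : Submodule ℝ X, (W : Set X) ⊆ C → Module.rank ℝ W ≤ k)

/-- `C` is `k`-solid: some `k`-dimensional subspace `W` has `W \ {0} ⊆ int C`. -/
def IsKSolid (C : Set X) (k : ℕ) : Prop :=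
  ∃ W : Submodule ℝ X, Module.rank ℝ W = k ∧ ((W : Set X) \ {0}) ⊆ interior C

/-- `C` is complemented: some closed subspace of codimension `k` meets `C` only at `0`. -/
def IsComplementedCone (C : Set X) (k : ℕ) : Prop :=
  ∃ H : Submodule ℝ X, IsClosed (H : Set X) ∧ Module.rank ℝ (X ⧸ H) = k ∧
    (H : Set X) ∩ C = {0}

/-- The positive semiorbit `O⁺(x)`. -/
def posOrbit (Φ : Semiflow X) (x : X) : Set X := {y | ∃ t, 0 ≤ t ∧ y = Φ.toFun t x}

/-- The ω-limit set `ω(x) = ⋂_{s ≥ 0} cl {Φ_t(x) : t ≥ s}`. -/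
def omegaSet (Φ : Semiflow X) (x : X) : Set X :=
  ⋂ s ∈ Set.Ici (0:ℝ), closure {y | ∃ t, s ≤ t ∧ y = Φ.toFun t x}

/-- The set of equilibria of `Φ`. -/
def equilibria (Φ : Semiflow X) : Set X := {p | ∀ t, 0 ≤ t → Φ.toFun t p = p}

/-- `S` is invariant: `Φ_t(S) = S` for all `t ≥ 0`. -/
def Invariant (Φ : Semiflow X) (S : Set X) : Prop := ∀ t, 0 ≤ t → Φ.toFun t '' S = S

/-- A set is ordered w.r.t. `C` if any two of its points are ordered. -/
def OrderedSet (C S : Set X) : Prop := ∀ x ∈ S, ∀ y ∈ S, x - y ∈ C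

/-- A set is unordered w.r.t. `C` if it is not a singleton and any two distinct points are
unordered. -/
def UnorderedSet (C S : Set X) : Prop :=
  (¬ ∃ a, S = {a}) ∧ ∀ x ∈ S, ∀ y ∈ S, x ≠ y → x - y ∉ C

/-- Two sets `A ∼ B`: every point of `A` is ordered with every point of `B`. -/
def SetsOrdered (C A B : Set X) : Prop := ∀ a ∈ A, ∀ b ∈ B, a - b ∈ C

/-- `Φ` is strongly monotone with respect to the cone `C`. -/
def StronglyMonotone (Φ : Semiflow X) (C : Set X) : Prop :=
  (∀ t, 0 ≤ t → ∀ x y : X, x - y ∈ C → Φ.toFun t x - Φ.toFun t y ∈ C) ∧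
  (∀ t, 0 < t → ∀ x y : X, x - y ∈ C → x ≠ y → Φ.toFun t x - Φ.toFun t y ∈ interior C)

/-- `O⁺(x)` is pseudo-ordered. -/
def PseudoOrdered (Φ : Semiflow X) (C : Set X) (x : X) : Prop :=
  ∃ t₁ t₂ : ℝ, 0 ≤ t₁ ∧ 0 ≤ t₂ ∧ Φ.toFun t₁ x ≠ Φ.toFun t₂ x ∧
    Φ.toFun t₁ x - Φ.toFun t₂ x ∈ C

/-- A bounded operator `R` is strongly focusing w.r.t. `C` with separation index `κ`:
`0 ∉ R(C \ {0})` and every unit vector of `RC` is at distance at least `κ` from `X \ C`. -/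
def StronglyFocusing (R : X →L[ℝ] X) (C : Set X) (κ : ℝ) : Prop :=
  (∀ v ∈ C, v ≠ 0 → R v ≠ 0) ∧
  (∀ v ∈ R '' C, ‖v‖ = 1 → ∀ u ∉ C, κ ≤ ‖v - u‖)

/-- `Φ` is strongly focusing monotone with respect to `C`, with `x`-derivative `DΦ`. -/
def StronglyFocusingMonotone (Φ : Semiflow X) (DΦ : ℝ → X → X →L[ℝ] X) (C : Set X) : Prop :=
  (∀ t, 0 ≤ t → ∀ x : X, HasFDerivAt (Φ.toFun t) (DΦ t x) x) ∧
  (∀ t, 0 ≤ t → Continuous fun x : X => DΦ t x) ∧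
  StronglyMonotone Φ C ∧
  (∀ t, 0 < t → ∀ x : X, ∀ v ∈ C, v ≠ 0 → DΦ t x v ∈ interior C) ∧
  (∀ S : Set X, IsCompact S → Invariant Φ S →
    ∃ δ > (0:ℝ), ∃ T > (0:ℝ), ∃ κ > (0:ℝ), ∀ z ∈ S, ∀ x ∈ Metric.closedBall z δ,
      ∀ y ∈ Metric.closedBall z δ, ∃ R : X →L[ℝ] X,
        StronglyFocusing R C κ ∧ R (x - y) = Φ.toFun T x - Φ.toFun T y)

/-- `ψ` is a flow extension of `Φ` on the invariant set `S`. -/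
def IsFlowExtensionOn (Φ : Semiflow X) (ψ : ℝ → X → X) (S : Set X) : Prop :=
  (∀ t, 0 ≤ t → ∀ z ∈ S, ψ t z = Φ.toFun t z) ∧
  (∀ t : ℝ, ∀ z ∈ S, ψ t z ∈ S) ∧
  (∀ s t : ℝ, ∀ z ∈ S, ψ s (ψ t z) = ψ (s + t) z) ∧
  ContinuousOn (fun p : ℝ × X => ψ p.1 p.2) (Set.univ ×ˢ S)

/-- `Φ` admits a flow extension on each ω-limit set. -/
def AdmitsFlowExtensions (Φ : Semiflow X) : Prop :=
  ∀ x : X, ∃ ψ : ℝ → X → X, IsFlowExtensionOn Φ ψ (omegaSet Φ x)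

/-- The α-limit set of `z` along the (extended) flow `ψ`. -/
def alphaSet (ψ : ℝ → X → X) (z : X) : Set X :=
  ⋂ s ∈ Set.Ici (0:ℝ), closure {y | ∃ t, s ≤ t ∧ y = ψ (-t) z}

/-- Standing assumptions: `C` is a complemented `k`-solid `k`-cone, the derivative
`D_xΦ_t` is a compact operator for all `x` and `t > 0`, and `Φ` admits a flow extension on
each ω-limit set. -/
def StandingAssumptions (Φ : Semiflow X) (DΦ : ℝ → X → X →L[ℝ] X)
    (C : Set X) (k : ℕ) : Prop :=
  IsKCone C k ∧ IsKSolid C k ∧ IsComplementedCone C k ∧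
  (∀ t, 0 < t → ∀ x : X, IsCompactOperator ⇑(DΦ t x)) ∧
  AdmitsFlowExtensions Φ

end Defs

section ExpSep

variable {X : Type*} [NormedAddCommGroup X] [NormedSpace ℝ X]

/-- A `k`-exponential separation of `(Φ_t, DΦ_t)` along the compact invariant set `S`,
associated with the cone `C`: continuous bundles `E_p` (`k`-dimensional) and `F_p`
(closed, `k`-codimensional) with `X = E_p ⊕ F_p`, invariance, the cone conditions
`E_p \ {0} ⊆ int C`, `F_p ∩ C = {0}`, and the dominated-splitting estimate. The
continuity of the bundles is expressed through a continuous family of projections. -/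
def KExpSeparation (Φ : Semiflow X) (DΦ : ℝ → X → X →L[ℝ] X) (C : Set X) (k : ℕ)
    (S : Set X) (Ep Fp : X → Submodule ℝ X) : Prop :=
  (∀ p ∈ S, Module.rank ℝ (Ep p) = k ∧ IsClosed ((Fp p : Set X)) ∧
    Module.rank ℝ (X ⧸ Fp p) = k ∧ IsCompl (Ep p) (Fp p)) ∧
  (∀ p ∈ S, ∀ t, 0 ≤ t →
    Submodule.map (DΦ t p : X →ₗ[ℝ] X) (Ep p) = Ep (Φ.toFun t p) ∧
    Submodule.map (DΦ t p : X →ₗ[ℝ] X) (Fp p) ≤ Fp (Φ.toFun t p)) ∧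
  (∀ p ∈ S, ((Ep p : Set X) \ {0}) ⊆ interior C ∧ (Fp p : Set X) ∩ C = {0}) ∧
  (∃ P : X → X →L[ℝ] X, ContinuousOn P S ∧ ∀ p ∈ S,
    (∀ v : X, P p v ∈ Ep p) ∧ (∀ v ∈ Ep p, P p v = v) ∧ (∀ v ∈ Fp p, P p v = 0)) ∧
  (∃ M > (0:ℝ), ∃ γ : ℝ, 0 < γ ∧ γ < 1 ∧ ∀ p ∈ S, ∀ t, 0 ≤ t →
    ∀ w ∈ Fp p, ‖w‖ = 1 → ∀ v ∈ Ep p, ‖v‖ = 1 →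
      ‖DΦ t p w‖ ≤ M * γ ^ t * ‖DΦ t p v‖)

end ExpSep

section ProjectionEstimates

variable {X : Type*} [NormedAddCommGroup X] [NormedSpace ℝ X]

theorem exists_ball_subset_of_finiteDimensional {E : Submodule ℝ X} [FiniteDimensional ℝ E]
    {U : Set X} (hU : IsOpen U) (hE : ((E : Set X) \ {0}) ⊆ U) (a b : ℝ) (ha : 0 < a) :
    ∃ ε > (0:ℝ), ∀ w ∈ E, a ≤ ‖w‖ → ‖w‖ ≤ b → ball w ε ⊆ U := by
  have hK : IsCompact (Subtype.val '' {w : E | a ≤ ‖w‖ ∧ ‖w‖ ≤ b}) := by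
    refine IsCompact.image ?_ continuous_subtype_val
    refine (isCompact_closedBall (0 : E) b).of_isClosed_subset ?_ ?_
    · exact (isClosed_le continuous_const continuous_norm).inter
        (isClosed_le continuous_norm continuous_const)
    · intro w hw
      simpa using hw.2
  have hKU : Subtype.val '' {w : E | a ≤ ‖w‖ ∧ ‖w‖ ≤ b} ⊆ U := by
    rintro _ ⟨w, hw, rfl⟩
    refine hE ⟨w.2, fun h0 => ?_⟩
    have h1 : w = 0 := Subtype.ext h0
    have h2 := hw.1
    rw [h1, norm_zero] at h2
    linarith
  obtain ⟨ε, hε, h⟩ := hK.exists_thickening_subset_open hU hKU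
  exact ⟨ε, hε, fun w hw h1 h2 =>
    Subset.trans (ball_subset_thickening (mem_image_of_mem Subtype.val
      (show (⟨w, hw⟩ : E) ∈ {w : E | a ≤ ‖w‖ ∧ ‖w‖ ≤ b} from ⟨h1, h2⟩)) ε) h⟩

theorem exists_uniform_ball_subset {S U : Set X} (hS : IsCompact S) (hU : IsOpen U)
    {E : X → Submodule ℝ X} (hfin : ∀ p ∈ S, FiniteDimensional ℝ (E p))
    (hE : ∀ p ∈ S, ((E p : Set X) \ {0}) ⊆ U) {P : X → X →L[ℝ] X} (hPc : ContinuousOn P S)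
    (hPE : ∀ p ∈ S, ∀ v, P p v ∈ E p) (hPid : ∀ p ∈ S, ∀ v ∈ E p, P p v = v) :
    ∃ δ > (0:ℝ), ∀ p ∈ S, ∀ e ∈ E p, ‖e‖ = 1 → ball e δ ⊆ U := by
  suffices h : ∃ δ > (0:ℝ), ∀ p ∈ S, p ∈ S → ∀ e ∈ E p, ‖e‖ = 1 → ball e δ ⊆ U by
    obtain ⟨δ, hδ, h⟩ := h
    exact ⟨δ, hδ, fun p hp => h p hp hp⟩
  refine hS.induction_on (p := fun s =>
    ∃ δ > (0:ℝ), ∀ p ∈ s, p ∈ S → ∀ e ∈ E p, ‖e‖ = 1 → ball e δ ⊆ U) ?_ ?_ ?_ ?_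
  · exact ⟨1, one_pos, by simp⟩
  · rintro s t hst ⟨δ, hδ, h⟩
    exact ⟨δ, hδ, fun p hp => h p (hst hp)⟩
  · rintro s t ⟨δ, hδ, h⟩ ⟨δ', hδ', h'⟩
    refine ⟨min δ δ', lt_min hδ hδ', ?_⟩
    rintro p (hp | hp) hpS e he h1
    · exact (ball_subset_ball (min_le_left _ _)).trans (h p hp hpS e he h1)
    · exact (ball_subset_ball (min_le_right _ _)).trans (h' p hp hpS e he h1)
  · intro q hq
    have := hfin q hq
    obtain ⟨ε, hε, hball⟩ :=
      exists_ball_subset_of_finiteDimensional hU (hE q hq) (1 / 2) 2 (by norm_num)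
    refine ⟨{p | dist (P p) (P q) < min (ε / 2) (1 / 2)},
      hPc q hq (ball_mem_nhds _ (by positivity)), ε / 2, by positivity, ?_⟩
    intro p hp hpS e he h1
    rw [mem_ofPred_eq, dist_eq_norm] at hp
    have hd : ‖e - P q e‖ ≤ ‖P p - P q‖ := by
      have := (P p - P q).le_opNorm e
      rwa [sub_apply, hPid p hpS e he, h1, mul_one] at this
    have hε2 := hp.trans_le (min_le_left _ _)
    have h12 := hp.trans_le (min_le_right _ _)
    have hlow := norm_sub_norm_le e (P q e)
    have hup := norm_sub_norm_le (P q e) e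
    rw [norm_sub_rev] at hup
    refine (ball_subset_ball' ?_).trans
      (hball (P q e) (hPE q hq e) (by linarith) (by linarith))
    rw [dist_eq_norm]
    linarith

theorem smul_mem_interior_of_smul_mem {C : Set X} (hC : ∀ (t : ℝ) (v : X), v ∈ C → t • v ∈ C)
    {t : ℝ} (ht : t ≠ 0) {v : X} (hv : v ∈ interior C) : t • v ∈ interior C := by
  have h : t • v ∈ interior ((fun x : X => t • x) '' C) := by
    have h' := mem_image_of_mem (Homeomorph.smulOfNeZero t ht) hv
    rwa [Homeomorph.image_interior] at h'
  refine interior_mono ?_ h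
  rintro _ ⟨x, hx, rfl⟩
  exact hC t x hx

theorem eq_of_isCompl_of_projection {E F : Submodule ℝ X} (h : IsCompl E F) {P Q : X →L[ℝ] X}
    (hP : ∀ v ∈ E, P v = v) (hP0 : ∀ v ∈ F, P v = 0)
    (hQ : ∀ v ∈ E, Q v = v) (hQ0 : ∀ v ∈ F, Q v = 0) : P = Q := by
  ext v
  obtain ⟨e, he, f, hf, rfl⟩ := Submodule.mem_sup.1 (h.sup_eq_top ▸ Submodule.mem_top : v ∈ E ⊔ F)
  rw [map_add, map_add, hP e he, hP0 f hf, hQ e he, hQ0 f hf]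

end ProjectionEstimates

/-- **Projection estimates (Lemma 3.4).** For a nonempty compact set `S ⊆ E` of
equilibria and a `k`-exponential separation along `S` associated with `C`, with
projections `P p` onto `E_p` along `F_p` (so `Π^{F_p} = I − P p`): (i) the projections
are uniformly bounded over `p ∈ S`; (ii) there is `κ_S > 0` such that any `v ≠ 0` with
`‖Π^{E_p} v‖ ≥ κ_S ‖Π^{F_p} v‖` for some `p ∈ S` lies in `int C`. -/
theorem projection_estimates
    {X : Type*} [NormedAddCommGroup X] [NormedSpace ℝ X] [CompleteSpace X]
    (Φ : Semiflow X) (DΦ : ℝ → X → X →L[ℝ] X) (C : Set X) (k : ℕ) (hk : 1 ≤ k)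
    (hSA : StandingAssumptions Φ DΦ C k)
    (hSFM : StronglyFocusingMonotone Φ DΦ C)
    (S : Set X) (hSne : S.Nonempty) (hScomp : IsCompact S) (hSE : S ⊆ equilibria Φ)
    (Ep Fp : X → Submodule ℝ X) (hsep : KExpSeparation Φ DΦ C k S Ep Fp)
    (P : X → X →L[ℝ] X)
    (hP : ∀ p ∈ S, (∀ v : X, P p v ∈ Ep p) ∧ (∀ v ∈ Ep p, P p v = v) ∧
      (∀ v ∈ Fp p, P p v = 0)) :
    (∃ M₀ : ℝ, ∀ p ∈ S, ‖P p‖ ≤ M₀ ∧ ‖ContinuousLinearMap.id ℝ X - P p‖ ≤ M₀) ∧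
    (∃ κS : ℝ, 0 < κS ∧ ∀ p ∈ S, ∀ v : X, v ≠ 0 →
      κS * ‖v - P p v‖ ≤ ‖P p v‖ → v ∈ interior C) := by
  obtain ⟨⟨-, hsmul, -, -⟩, -⟩ := hSA
  obtain ⟨hrank, -, hcone, ⟨Q, hQc, hQ⟩, -⟩ := hsep
  have hPQ : ∀ p ∈ S, P p = Q p := fun p hp =>
    eq_of_isCompl_of_projection (hrank p hp).2.2.2 (hP p hp).2.1 (hP p hp).2.2
      (hQ p hp).2.1 (hQ p hp).2.2
  have hPc : ContinuousOn P S := hQc.congr hPQ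
  constructor
  · obtain ⟨M, hM⟩ := hScomp.exists_bound_of_continuousOn hPc
    obtain ⟨N, hN⟩ := hScomp.exists_bound_of_continuousOn
      (continuousOn_const (c := ContinuousLinearMap.id ℝ X) |>.sub hPc)
    exact ⟨max M N, fun p hp =>
      ⟨(hM p hp).trans (le_max_left _ _), (hN p hp).trans (le_max_right _ _)⟩⟩
  · obtain ⟨δ, hδ, hball⟩ := exists_uniform_ball_subset hScomp isOpen_interior
      (fun p hp => Module.finite_of_rank_eq_nat (hrank p hp).1) (fun p hp => (hcone p hp).1)
      hPc (fun p hp => (hP p hp).1) (fun p hp => (hP p hp).2.1)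
    refine ⟨2 / δ, by positivity, fun p hp v hv hle => ?_⟩
    have hne : P p v ≠ 0 := by
      intro h0
      rw [h0, sub_zero, norm_zero] at hle
      have : 0 < 2 / δ * ‖v‖ := by positivity
      linarith
    have hpos : 0 < ‖P p v‖ := norm_pos_iff.2 hne
    have hmem : ‖P p v‖⁻¹ • v ∈ interior C := by
      refine hball p hp (‖P p v‖⁻¹ • P p v) (Submodule.smul_mem _ _ ((hP p hp).1 v))
        ?_ ?_
      · rw [norm_smul, norm_inv, norm_norm, inv_mul_cancel₀ hpos.ne']
      · rw [mem_ball, dist_eq_norm, ← smul_sub, norm_smul, norm_inv, norm_norm,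
          inv_mul_lt_iff₀ hpos]
        rw [div_mul_eq_mul_div, div_le_iff₀ hδ] at hle
        nlinarith [mul_pos hpos hδ]
    have := smul_mem_interior_of_smul_mem hsmul hpos.ne' hmem
    rwa [smul_inv_smul₀ hpos.ne'] at this
end

section
/- Instability lemma (Lemma 3.5): Let Φ be a semiflow on X strongly focusing monotone with respect to the k-cone C, satisfying the standing assumptions. Let x ∈ X have nonempty compact ω-limit set ω(x), let ω(x)×(E_z), ω(x)×(F_z) be the bundles of a k-exponential separation along ω(x) associated with C, and assume that the k-Lyapunov exponent λ_{kz} > 0 for every z ∈ ω(x). Then there exists δ″ > 0 such that for every y ∈ M_x = {y ∈ X : y − x ∈ C, y ≠ x}, limsup_{t→∞} ‖Φ_t(y) − Φ_t(x)‖ ≥ δ″. -/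
open Set Metric Filter

section Lyap

variable {X : Type*} [NormedAddCommGroup X] [NormedSpace ℝ X]

/-- The infimum norm `m(A|_E) = inf {‖A v‖ : v ∈ E, ‖v‖ = 1}`. -/
noncomputable def infNorm (A : X →L[ℝ] X) (E : Submodule ℝ X) : ℝ :=
  sInf {r : ℝ | ∃ v ∈ E, ‖v‖ = 1 ∧ r = ‖A v‖}

/-- The `k`-Lyapunov exponent `λ_{kz} = limsup_{t→∞} t⁻¹ log m(D_zΦ_t|_{E_z})`. -/
noncomputable def kLyap (DΦ : ℝ → X → X →L[ℝ] X) (Ep : X → Submodule ℝ X) (z : X) : ℝ :=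
  Filter.limsup (fun t : ℝ => Real.log (infNorm (DΦ t z) (Ep z)) / t) Filter.atTop

end Lyap

open scoped Topology

section Instability

theorem nonpos_of_doubling {g : ℝ → ℝ} {t₀ b : ℝ} (hb : ∀ t, t₀ ≤ t → g t ≤ b)
    (h : ∀ t, t₀ ≤ t → ∃ τ, 0 ≤ τ ∧ 2 * g t ≤ g (t + τ)) {t : ℝ} (ht : t₀ ≤ t) : g t ≤ 0 := by
  have key : ∀ n : ℕ, ∀ t, t₀ ≤ t → 2 ^ n * g t ≤ b := by
    intro n
    induction n with
    | zero => intro t ht; simpa using hb t ht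
    | succ n ih =>
      intro t ht
      obtain ⟨τ, hτ, h2⟩ := h t ht
      calc 2 ^ (n + 1) * g t = 2 ^ n * (2 * g t) := by ring
        _ ≤ 2 ^ n * g (t + τ) := by gcongr
        _ ≤ b := ih _ (by linarith)
  by_contra! hpos
  obtain ⟨n, hn⟩ := pow_unbounded_of_one_lt (b / g t) (one_lt_two : (1 : ℝ) < 2)
  rw [div_lt_iff₀ hpos] at hn
  exact absurd (key n t ht) (not_le.mpr hn)

variable {X : Type*} [NormedAddCommGroup X] [NormedSpace ℝ X]

theorem infNorm_nonneg (A : X →L[ℝ] X) (E : Submodule ℝ X) : 0 ≤ infNorm A E := by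
  refine Real.sInf_nonneg ?_
  rintro r ⟨v, -, -, rfl⟩
  positivity

theorem infNorm_mul_norm_le (A : X →L[ℝ] X) {E : Submodule ℝ X} {v : X} (hv : v ∈ E) :
    infNorm A E * ‖v‖ ≤ ‖A v‖ := by
  rcases eq_or_ne v 0 with rfl | h0
  · simp
  have hn : 0 < ‖v‖ := norm_pos_iff.mpr h0
  have h : infNorm A E ≤ ‖A (‖v‖⁻¹ • v)‖ := by
    refine csInf_le ⟨0, ?_⟩ ⟨_, E.smul_mem _ hv, norm_smul_inv_norm h0, rfl⟩
    rintro r ⟨v, -, -, rfl⟩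
    positivity
  rw [map_smul, norm_smul, norm_inv, norm_norm, inv_mul_eq_div, le_div_iff₀ hn] at h
  exact h

theorem exists_infNorm_gt {DΦ : ℝ → X → X →L[ℝ] X} {Ep : X → Submodule ℝ X} {z : X}
    (h : 0 < kLyap DΦ Ep z) (N : ℝ) : ∃ τ, 0 ≤ τ ∧ N < infNorm (DΦ τ z) (Ep z) := by
  by_contra! hN
  rw [kLyap, limsup_eq] at h
  set S := {a : ℝ | ∀ᶠ t : ℝ in atTop, Real.log (infNorm (DΦ t z) (Ep z)) / t ≤ a} with hS
  have hbdd : BddBelow S := by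
    by_contra hb
    rw [Real.sInf_of_not_bddBelow hb] at h
    exact lt_irrefl _ h
  have hmem : sInf S / 2 ∈ S := by
    filter_upwards [eventually_gt_atTop 0, eventually_ge_atTop (|Real.log N| / (sInf S / 2))]
      with t ht ht'
    have hpos : 0 < sInf S / 2 := half_pos h
    rw [div_le_iff₀ hpos] at ht'
    rw [div_le_iff₀ ht, mul_comm]
    rcases (infNorm_nonneg (DΦ t z) (Ep z)).eq_or_lt with h0 | h0
    · rw [← h0, Real.log_zero]
      positivity
    · exact (Real.log_le_log h0 (hN t ht.le)).trans ((le_abs_self _).trans ht')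
  linarith [csInf_le hbdd hmem]

theorem Semiflow.continuous_max (Φ : Semiflow X) :
    Continuous fun p : ℝ × X => Φ.toFun (max p.1 0) p.2 := by
  have h : Continuous fun p : ℝ × X => (max p.1 0, p.2) := by fun_prop
  refine Φ.cont.comp_continuous h fun p => ?_
  simp

theorem Semiflow.continuous_apply (Φ : Semiflow X) {t : ℝ} (ht : 0 ≤ t) :
    Continuous (Φ.toFun t) := by
  have h : Continuous fun p : X => Φ.toFun (max t 0) p :=
    Φ.continuous_max.comp (by fun_prop : Continuous fun p : X => (t, p))
  rwa [max_eq_left ht] at h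

theorem Semiflow.continuous_orbit_max (Φ : Semiflow X) (x : X) :
    Continuous fun t : ℝ => Φ.toFun (max t 0) x :=
  Φ.continuous_max.comp (by fun_prop : Continuous fun t : ℝ => (t, x))

/-- Near any point, a `C¹` map is strictly approximated by its derivative there. -/
theorem exists_ball_norm_sub_sub_le {f : X → X} {f' : X → X →L[ℝ] X}
    (hf : ∀ p, HasFDerivAt f (f' p) p) (hf' : Continuous f') (z : X) {η : ℝ} (hη : 0 < η) :
    ∃ r > 0, ∀ p ∈ ball z r, ∀ q ∈ ball z r, ‖f p - f q - f' z (p - q)‖ ≤ η * ‖p - q‖ := by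
  have h := (hasStrictFDerivAt_of_hasFDerivAt_of_continuousAt (Eventually.of_forall hf)
    hf'.continuousAt : HasStrictFDerivAt f (f' z) z).isLittleO.def hη
  obtain ⟨r, hr, hball⟩ := Metric.eventually_nhds_iff_ball.mp h
  refine ⟨r, hr, fun p hp q hq => hball (p, q) ?_⟩
  rw [← ball_prod_same]
  exact ⟨hp, hq⟩

section Omega

variable {Φ : Semiflow X} {x : X}

theorem IsFlowExtensionOn.invariant {ψ : ℝ → X → X} {S : Set X} (h : IsFlowExtensionOn Φ ψ S) :
    Invariant Φ S := by
  obtain ⟨h1, h2, h3, -⟩ := h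
  intro t ht
  refine Subset.antisymm ?_ fun z hz => ⟨ψ (-t) z, h2 _ z hz, ?_⟩
  · rintro _ ⟨z, hz, rfl⟩
    exact h1 t ht z hz ▸ h2 t z hz
  · rw [← h1 t ht _ (h2 _ z hz), h3 _ _ z hz, add_neg_cancel, h1 0 le_rfl z hz, Φ.map_zero]

theorem Invariant.apply_mem {S : Set X} (h : Invariant Φ S) {t : ℝ} (ht : 0 ≤ t) {z : X}
    (hz : z ∈ S) : Φ.toFun t z ∈ S :=
  h t ht ▸ mem_image_of_mem _ hz

theorem exists_dist_lt_of_mem_omegaSet {z : X} (hz : z ∈ omegaSet Φ x) (s : ℝ) {U : Set X}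
    (hU : U ∈ 𝓝 z) : ∃ t, 0 ≤ t ∧ s ≤ t ∧ Φ.toFun t x ∈ U := by
  have h := mem_iInter₂.mp hz (max s 0) (le_max_right s 0)
  obtain ⟨_, hU', t, ht, rfl⟩ := mem_closure_iff_nhds.mp h U hU
  exact ⟨t, (le_max_right s 0).trans ht, (le_max_left s 0).trans ht, hU'⟩

theorem mem_omegaSet_of_tendsto {ι : Type*} {l : Filter ι} [l.NeBot] {t : ι → ℝ}
    (ht : Tendsto t l atTop) {z : X} (h : Tendsto (fun i => Φ.toFun (t i) x) l (𝓝 z)) :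
    z ∈ omegaSet Φ x := by
  refine mem_iInter₂.mpr fun s _ => mem_closure_of_tendsto h ?_
  filter_upwards [ht.eventually_ge_atTop s] with i hi using ⟨t i, hi, rfl⟩

end Omega

section Attraction

variable {Φ : Semiflow X} {x : X}

/-- An orbit which returns near `ω(x)` and leaves it again stays near `ω(x)` for arbitrarily long
times before leaving. -/
theorem exists_long_stay (hne : (omegaSet Φ x).Nonempty) (hinv : Invariant Φ (omegaSet Φ x))
    {ρ : ℝ} (hρ : 0 < ρ) (hfar : ∀ s, ∃ t, s ≤ t ∧ ρ ≤ infDist (Φ.toFun (max t 0) x) (omegaSet Φ x))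
    (n : ℝ) (hn : 0 ≤ n) : ∃ τ, n ≤ τ - n ∧ infDist (Φ.toFun τ x) (omegaSet Φ x) = ρ ∧
      ∀ s, τ - n ≤ s → s ≤ τ → infDist (Φ.toFun s x) (omegaSet Φ x) ≤ ρ := by
  obtain ⟨z, hz⟩ := hne
  set K := omegaSet Φ x with hK
  set d : ℝ → ℝ := fun t => infDist (Φ.toFun (max t 0) x) K with hd
  have hdc : Continuous d := (continuous_infDist_pt K).comp (Φ.continuous_orbit_max x)
  have htube : ∀ᶠ p in 𝓝 z, ∀ s ∈ Icc 0 n, infDist (Φ.toFun (max s 0) p) K < ρ := by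
    refine isCompact_Icc.eventually_forall_of_forall_eventually fun s hs => ?_
    have hc : Continuous fun q : X × ℝ => infDist (Φ.toFun (max q.2 0) q.1) K :=
      (continuous_infDist_pt K).comp (Φ.continuous_max.comp continuous_swap)
    refine hc.continuousAt.eventually_lt continuousAt_const ?_
    rwa [infDist_zero_of_mem (hinv.apply_mem (le_max_right s 0) hz)]
  obtain ⟨t, ht0, htn, ht⟩ := exists_dist_lt_of_mem_omegaSet hz n htube
  have hnear : ∀ s, t ≤ s → s ≤ t + n → d s < ρ := by
    intro s hs hs'
    have h := ht (s - t) ⟨by linarith, by linarith⟩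
    rw [max_eq_left (by linarith), ← Φ.map_add _ _ (by linarith) ht0, sub_add_cancel] at h
    simpa only [hd, max_eq_left (ht0.trans hs)] using h
  obtain ⟨t', htt', ht'⟩ := hfar t
  set S := {s | t ≤ s ∧ ρ ≤ d s} with hS
  have hSc : IsClosed S := isClosed_Ici.inter (isClosed_le continuous_const hdc)
  have hSb : BddBelow S := ⟨t, fun s hs => hs.1⟩
  have hτ : sInf S ∈ S := hSc.csInf_mem ⟨t', htt', ht'⟩ hSb
  set τ := sInf S with hτdef
  have hlt : ∀ s, t ≤ s → s < τ → d s < ρ := fun s hs hsτ =>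
    lt_of_not_ge fun h => absurd (csInf_le hSb ⟨hs, h⟩) (not_le.mpr hsτ)
  have hτn : t + n < τ := lt_of_not_ge fun h => absurd (hnear τ hτ.1 h) (not_lt.mpr hτ.2)
  have hτeq : d τ = ρ := by
    obtain ⟨s, hs, hsρ⟩ := intermediate_value_Icc hτ.1 hdc.continuousOn
      ⟨(hnear t le_rfl (by linarith)).le, hτ.2⟩
    rcases hs.2.eq_or_lt with h | h
    · rw [← h, hsρ]
    · exact absurd hsρ (hlt s hs.1 h).ne
  refine ⟨τ, by linarith, ?_, fun s hs hs' => ?_⟩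
  · simpa only [hd, max_eq_left (ht0.trans hτ.1)] using hτeq
  · have hts : t ≤ s := by linarith
    have h : d s ≤ ρ := by
      rcases hs'.eq_or_lt with rfl | h
      · exact hτeq.le
      · exact (hlt s hts h).le
    simpa only [hd, max_eq_left (ht0.trans hts)] using h

theorem exists_mem_norm_sub_le_of_tendsto {Y : Type*} [SeminormedAddCommGroup Y]
    {𝒰 : Filter ℕ} {b : ℕ → Y} {q : Y}
    (h : Tendsto b 𝒰 (𝓝 q)) {ε : ℝ} (hε : 0 < ε) :
    ∃ A ∈ 𝒰, ∀ m ∈ A, ∀ n ∈ A, ‖b m - b n‖ ≤ ε := by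
  refine ⟨_, h (ball_mem_nhds q (half_pos hε)), fun m hm n hn => ?_⟩
  rw [← dist_eq_norm]
  have hm' : dist (b m) q < ε / 2 := hm
  have hn' : dist (b n) q < ε / 2 := hn
  linarith [dist_triangle_right (b m) (b n) q]

/-- If the derivative of a `C¹` map is compact along the compact set `K`, then near `K` the map
halves the oscillation of sequences along any ultrafilter. -/
theorem exists_halving_radius {f : X → X} {f' : X → X →L[ℝ] X}
    (hf : ∀ p, HasFDerivAt f (f' p) p) (hf' : Continuous f')
    (hcomp : ∀ p, IsCompactOperator (f' p)) {K : Set X} (hK : IsCompact K) :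
    ∃ r > 0, ∀ (𝒰 : Ultrafilter ℕ) (a : ℕ → X) (ρ d : ℝ), ρ < r → 0 < d →
      (∀ᶠ n in (𝒰 : Filter ℕ), ∃ z ∈ K, dist (a n) z ≤ ρ) →
      (∃ A ∈ 𝒰, ∀ m ∈ A, ∀ n ∈ A, ‖a m - a n‖ ≤ d) →
      ∃ A ∈ 𝒰, ∀ m ∈ A, ∀ n ∈ A, ‖f (a m) - f (a n)‖ ≤ d / 2 := by
  choose R hR hRf using fun z => exists_ball_norm_sub_sub_le hf hf' z
    (by norm_num : (0 : ℝ) < 1 / 4)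
  obtain ⟨r, hr, hleb⟩ := lebesgue_number_lemma_of_metric hK (c := fun z : X => ball z (R z))
    (fun z => isOpen_ball) fun z _ => mem_iUnion.mpr ⟨z, mem_ball_self (hR z)⟩
  refine ⟨r, hr, fun 𝒰 a ρ d hρ hd hnear ⟨A, hA, hAd⟩ => ?_⟩
  have hnear' : ∀ n, ∃ z, (∃ z ∈ K, dist (a n) z ≤ ρ) → z ∈ K ∧ dist (a n) z ≤ ρ := by
    intro n
    by_cases h : ∃ z ∈ K, dist (a n) z ≤ ρ
    · exact h.imp fun z hz _ => hz
    · exact ⟨0, fun h' => absurd h' h⟩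
  choose w hw using hnear'
  obtain ⟨z, hz, hwz⟩ := hK.ultrafilter_le_nhds (𝒰.map w) <| by
    rw [le_principal_iff, Ultrafilter.mem_coe, Ultrafilter.mem_map]
    filter_upwards [hnear] with n hn using (hw n hn).1
  obtain ⟨c, hc⟩ := hleb z hz
  have hball : ∀ᶠ n in (𝒰 : Filter ℕ), a n ∈ ball c (R c) := by
    have h1 : ∀ᶠ n in (𝒰 : Filter ℕ), w n ∈ ball z (r - ρ) :=
      hwz (ball_mem_nhds z (sub_pos.mpr hρ))
    filter_upwards [h1, hnear] with n hn hn'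
    refine hc (mem_ball.mpr ?_)
    linarith [dist_triangle (a n) (w n) z, (hw n hn').2, mem_ball.mp hn]
  have himg : IsCompact (closure (f' c '' ball c (R c))) :=
    (hcomp c).isCompact_closure_image_of_bounded (f := (f' c : X →ₗ[ℝ] X)) isBounded_ball
  obtain ⟨q, -, hq⟩ := himg.ultrafilter_le_nhds (𝒰.map fun n => f' c (a n)) <| by
    rw [le_principal_iff, Ultrafilter.mem_coe, Ultrafilter.mem_map]
    filter_upwards [hball] with n hn using subset_closure (mem_image_of_mem _ hn)
  obtain ⟨B, hB, hBd⟩ := exists_mem_norm_sub_le_of_tendsto (b := fun n => f' c (a n)) (q := q) hq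
    (by positivity : 0 < d / 4)
  refine ⟨A ∩ B ∩ {n | a n ∈ ball c (R c)}, inter_mem (inter_mem hA hB) hball, ?_⟩
  rintro m ⟨⟨hmA, hmB⟩, hm⟩ n ⟨⟨hnA, hnB⟩, hn⟩
  have h1 := hRf c _ hm _ hn
  have h2 := hBd m hmB n hnB
  have h3 := hAd m hmA n hnA
  rw [← map_sub] at h2
  have h4 := norm_le_norm_sub_add (f (a m) - f (a n)) (f' c (a m - a n))
  linarith

/-- A nonempty compact `ω`-limit set attracts its orbit when the time-one map has compact
derivatives. -/
theorem exists_forall_infDist_omegaSet_lt [CompleteSpace X] {f' : X → X →L[ℝ] X}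
    (hf : ∀ p, HasFDerivAt (Φ.toFun 1) (f' p) p) (hf' : Continuous f')
    (hcomp : ∀ p, IsCompactOperator (f' p)) (hne : (omegaSet Φ x).Nonempty)
    (hinv : Invariant Φ (omegaSet Φ x)) (hK : IsCompact (omegaSet Φ x)) {ε : ℝ} (hε : 0 < ε) :
    ∃ t₀, 0 ≤ t₀ ∧ ∀ t, t₀ ≤ t → infDist (Φ.toFun t x) (omegaSet Φ x) < ε := by
  by_contra! hfar
  obtain ⟨r, hr, hhalf⟩ := exists_halving_radius hf hf' hcomp hK
  set ρ := min ε (r / 2) with hρdef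
  have hρ : 0 < ρ := lt_min hε (half_pos hr)
  have hρr : ρ < r := (min_le_right _ _).trans_lt (half_lt_self hr)
  have hfar' : ∀ s, ∃ t, s ≤ t ∧ ρ ≤ infDist (Φ.toFun (max t 0) x) (omegaSet Φ x) := by
    intro s
    obtain ⟨t, ht, h⟩ := hfar (max s 0) (le_max_right _ _)
    refine ⟨t, (le_max_left _ _).trans ht, ?_⟩
    rw [max_eq_left ((le_max_right _ _).trans ht)]
    exact (min_le_left _ _).trans h
  choose τ hτn hτρ hτle using fun n : ℕ => exists_long_stay hne hinv hρ hfar' n n.cast_nonneg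
  let 𝒰 : Ultrafilter ℕ := Ultrafilter.of atTop
  have h𝒰 : (𝒰 : Filter ℕ) ≤ atTop := Ultrafilter.of_le atTop
  set a : ℕ → ℕ → X := fun j n => Φ.toFun (τ n - j) x with ha
  have hnear : ∀ j, ∀ᶠ n in (𝒰 : Filter ℕ), ∃ z ∈ omegaSet Φ x, dist (a j n) z ≤ ρ := by
    intro j
    filter_upwards [h𝒰 (eventually_ge_atTop j)] with n hn
    have hn' : (j : ℝ) ≤ n := by exact_mod_cast hn
    obtain ⟨z, hz, hzd⟩ := hK.exists_infDist_eq_dist hne (a j n)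
    refine ⟨z, hz, hzd ▸ hτle n _ (by linarith) ?_⟩
    linarith [(j.cast_nonneg : (0 : ℝ) ≤ j)]
  have hstep : ∀ j, ∀ᶠ n in (𝒰 : Filter ℕ), a j n = Φ.toFun 1 (a (j + 1) n) := by
    intro j
    filter_upwards [h𝒰 (eventually_ge_atTop (j + 1))] with n hn
    have hn' : (j : ℝ) + 1 ≤ n := by exact_mod_cast hn
    have := hτn n
    simp only [ha]
    rw [← Φ.map_add _ _ zero_le_one (by push_cast; linarith)]
    congr 1
    push_cast
    ring
  obtain ⟨D, hD, hDiam⟩ : ∃ D > 0, ∀ p ∈ omegaSet Φ x, ∀ q ∈ omegaSet Φ x, dist p q ≤ D := by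
    obtain ⟨D, hD⟩ := isBounded_iff.mp hK.isBounded
    exact ⟨max D 1, by positivity, fun p hp q hq => (hD hp hq).trans (le_max_left _ _)⟩
  have hosc : ∀ i j, ∃ A ∈ 𝒰, ∀ m ∈ A, ∀ n ∈ A, ‖a j m - a j n‖ ≤ (D + 2 * ρ) / 2 ^ i := by
    intro i
    induction i with
    | zero =>
      refine fun j => ⟨_, hnear j, ?_⟩
      rintro m ⟨z, hz, hmz⟩ n ⟨w, hw, hnw⟩
      rw [← dist_eq_norm, pow_zero, div_one]
      linarith [dist_triangle4_right (a j m) (a j n) z w, hDiam z hz w hw]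
    | succ i ih =>
      intro j
      obtain ⟨A, hA, h⟩ := hhalf 𝒰 (a (j + 1)) ρ _ hρr (by positivity) (hnear (j + 1)) (ih (j + 1))
      refine ⟨_, inter_mem hA (hstep j), fun m hm n hn => ?_⟩
      rw [show a j m = _ from hm.2, show a j n = _ from hn.2, pow_succ, ← div_div]
      exact h m hm.1 n hn.1
  have hcauchy : Cauchy (map (a 0) (𝒰 : Filter ℕ)) := by
    refine Metric.cauchy_iff.mpr ⟨inferInstance, fun η hη => ?_⟩
    obtain ⟨i, hi⟩ := pow_unbounded_of_one_lt ((D + 2 * ρ) / η) (one_lt_two : (1 : ℝ) < 2)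
    obtain ⟨A, hA, h⟩ := hosc i 0
    refine ⟨a 0 '' A, image_mem_map hA, ?_⟩
    rintro _ ⟨m, hm, rfl⟩ _ ⟨n, hn, rfl⟩
    rw [dist_eq_norm]
    refine (h m hm n hn).trans_lt ?_
    rwa [div_lt_comm₀ (by positivity) hη]
  obtain ⟨p, hp⟩ := CompleteSpace.complete hcauchy
  have hp' : Tendsto (fun n => Φ.toFun (τ n) x) 𝒰 (𝓝 p) := by
    simpa only [ha, Nat.cast_zero, sub_zero] using (show Tendsto (a 0) 𝒰 (𝓝 p) from hp)
  have hτtop : Tendsto τ (𝒰 : Filter ℕ) atTop :=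
    (tendsto_atTop_mono (fun n => by linarith [hτn n, (n.cast_nonneg : (0 : ℝ) ≤ n)])
      tendsto_natCast_atTop_atTop).mono_left h𝒰
  have hpω : p ∈ omegaSet Φ x := mem_omegaSet_of_tendsto hτtop hp'
  have hlim := ((continuous_infDist_pt (omegaSet Φ x)).tendsto p).comp hp'
  have hconst : Tendsto (fun _ : ℕ => ρ) (𝒰 : Filter ℕ) (𝓝 0) := by
    simpa only [infDist_zero_of_mem hpω, Function.comp_def, hτρ] using hlim
  exact hρ.ne (tendsto_nhds_unique hconst tendsto_const_nhds)

end Attraction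

section Expansion

variable {Φ : Semiflow X} {DΦ : ℝ → X → X →L[ℝ] X} {Ep Fp : X → Submodule ℝ X}

theorem sub_apply_mem_of_isCompl {E F : Submodule ℝ X} (h : IsCompl E F) {P : X →L[ℝ] X}
    (hPE : ∀ v ∈ E, P v = v) (hPF : ∀ v ∈ F, P v = 0) (v : X) : v - P v ∈ F := by
  obtain ⟨e, he, f, hf, rfl⟩ := Submodule.mem_sup.mp (h.sup_eq_top ▸ Submodule.mem_top : v ∈ E ⊔ F)
  rw [map_add, hPE e he, hPF f hf, add_zero, add_sub_cancel_left]
  exact hf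

/-- Near a point with positive `k`-Lyapunov exponent, some time map at least doubles the distance
of any two points whose difference is uniformly transverse to the bundle `Fp`. -/
theorem exists_expanding_ball {K : Set X} {P : X → X →L[ℝ] X} {B c : ℝ} {z : X}
    (hder : ∀ t, 0 ≤ t → ∀ p, HasFDerivAt (Φ.toFun t) (DΦ t p) p)
    (hcont : ∀ t, 0 ≤ t → Continuous fun p => DΦ t p) (hinv : Invariant Φ K)
    (hcompl : ∀ p ∈ K, IsCompl (Ep p) (Fp p))
    (hmap : ∀ p ∈ K, ∀ t, 0 ≤ t →
      Submodule.map (DΦ t p : X →ₗ[ℝ] X) (Ep p) = Ep (Φ.toFun t p) ∧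
      Submodule.map (DΦ t p : X →ₗ[ℝ] X) (Fp p) ≤ Fp (Φ.toFun t p))
    (hP : ∀ p ∈ K, (∀ v : X, P p v ∈ Ep p) ∧ (∀ v ∈ Ep p, P p v = v) ∧ (∀ v ∈ Fp p, P p v = 0))
    (hB : 0 < B) (hPB : ∀ p ∈ K, ‖P p‖ ≤ B) (hc : 0 < c) (hz : z ∈ K)
    (hLyap : 0 < kLyap DΦ Ep z) :
    ∃ τ, 0 ≤ τ ∧ ∃ r > 0, ∀ p ∈ ball z r, ∀ q ∈ ball z r,
      c * ‖p - q‖ ≤ ‖P z (p - q)‖ → 2 * ‖p - q‖ ≤ ‖Φ.toFun τ p - Φ.toFun τ q‖ := by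
  obtain ⟨τ, hτ, hm⟩ := exists_infNorm_gt hLyap (3 * B / c)
  obtain ⟨r, hr, happrox⟩ := exists_ball_norm_sub_sub_le (hder τ hτ) (hcont τ hτ) z one_pos
  refine ⟨τ, hτ, r, hr, fun p hp q hq hpq => ?_⟩
  have h1 := happrox p hp q hq
  set v := p - q
  have hz' := hinv.apply_mem hτ hz
  obtain ⟨hPE, hPid, hPker⟩ := hP z hz
  obtain ⟨-, hPid', hPker'⟩ := hP _ hz'
  have hcomm : P (Φ.toFun τ z) (DΦ τ z v) = DΦ τ z (P z v) := by
    have hE : DΦ τ z (P z v) ∈ Ep (Φ.toFun τ z) :=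
      (hmap z hz τ hτ).1 ▸ Submodule.mem_map_of_mem (f := (DΦ τ z : X →ₗ[ℝ] X)) (hPE v)
    have hF : DΦ τ z (v - P z v) ∈ Fp (Φ.toFun τ z) :=
      (hmap z hz τ hτ).2 <| Submodule.mem_map_of_mem (f := (DΦ τ z : X →ₗ[ℝ] X)) <|
        sub_apply_mem_of_isCompl (hcompl z hz) hPid hPker v
    have h := hPker' _ hF
    rwa [map_sub, map_sub, hPid' _ hE, sub_eq_zero] at h
  have h2 : B * (3 * ‖v‖) ≤ B * ‖DΦ τ z v‖ := by
    have := infNorm_nonneg (DΦ τ z) (Ep z)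
    calc B * (3 * ‖v‖) = 3 * B / c * (c * ‖v‖) := by field_simp
      _ ≤ infNorm (DΦ τ z) (Ep z) * ‖P z v‖ := by gcongr
      _ ≤ ‖DΦ τ z (P z v)‖ := infNorm_mul_norm_le _ (hPE v)
      _ = ‖P (Φ.toFun τ z) (DΦ τ z v)‖ := by rw [hcomm]
      _ ≤ B * ‖DΦ τ z v‖ := (P _).le_of_opNorm_le (hPB _ hz') _
  have h3 := le_of_mul_le_mul_left h2 hB
  have h4 := norm_le_norm_add_norm_sub' (DΦ τ z v) (Φ.toFun τ p - Φ.toFun τ q)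
  rw [norm_sub_rev (DΦ τ z v)] at h4
  linarith

/-- The image of a cone under a strongly focusing operator is uniformly transverse to any subspace
that meets the cone only at the origin. -/
theorem StronglyFocusing.mul_norm_le {R P : X →L[ℝ] X} {C : Set X} {κ : ℝ}
    (hR : StronglyFocusing R C κ) (hC : ∀ (t : ℝ) (v : X), v ∈ C → t • v ∈ C)
    {F : Submodule ℝ X} (hF : (F : Set X) ∩ C = {0}) (hPF : ∀ v, v - P v ∈ F) {w : X}
    (hw : w ∈ C) : min κ 1 * ‖R w‖ ≤ ‖P (R w)‖ := by
  rcases eq_or_ne (R w) 0 with h0 | h0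
  · simp [h0]
  have hn : 0 < ‖R w‖ := norm_pos_iff.mpr h0
  set u := ‖R w‖⁻¹ • R w with hu
  have hu1 : ‖u‖ = 1 := norm_smul_inv_norm h0
  have huR : u ∈ R '' C := ⟨‖R w‖⁻¹ • w, hC _ _ hw, map_smul R _ _⟩
  have key : min κ 1 ≤ ‖P u‖ := by
    by_cases hmem : u - P u ∈ C
    · have h : u - P u = 0 := by
        have h : u - P u ∈ (F : Set X) ∩ C := ⟨hPF u, hmem⟩
        rwa [hF] at h
      rw [← sub_eq_zero.mp h, hu1]
      exact min_le_right _ _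
    · have h := hR.2 u huR hu1 _ hmem
      rw [sub_sub_cancel] at h
      exact (min_le_left _ _).trans h
  rwa [hu, map_smul, norm_smul, norm_inv, norm_norm, inv_mul_eq_div, le_div_iff₀ hn] at key

end Expansion

section Merging

variable {Φ : Semiflow X} {ψ : ℝ → X → X} {K : Set X}

/-- If a time map is injective near the compact set `K` carrying a flow, then orbits can only enter
`K` along the flow. -/
theorem eq_flow_neg_of_apply_mem (hψ : IsFlowExtensionOn Φ ψ K) {δ T : ℝ} (hδ : 0 < δ) (hT : 0 < T)
    (hinj : ∀ z ∈ K, ∀ p ∈ closedBall z δ, ∀ q ∈ closedBall z δ,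
      Φ.toFun T p = Φ.toFun T q → p = q) {s : ℝ} (hs : 0 ≤ s) {q : X} (hq : Φ.toFun s q ∈ K) :
    q = ψ (-s) (Φ.toFun s q) := by
  obtain ⟨hψΦ, hψK, hψadd, hψc⟩ := hψ
  set p := Φ.toFun s q with hp
  set g : ℝ → X := fun t => Φ.toFun (max t 0) q with hg
  set h : ℝ → X := fun t => ψ (t - s) p with hh
  have hgc : Continuous g := Φ.continuous_orbit_max q
  have hhc : Continuous h := hψc.comp_continuous
    (by fun_prop : Continuous fun t : ℝ => (t - s, p)) fun t => ⟨mem_univ _, hq⟩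
  set A := {t | (0 ≤ t ∧ t ≤ s) ∧ g t = h t} with hA
  have hAc : IsClosed A := isClosed_Icc.inter (isClosed_eq hgc hhc)
  have hAb : BddBelow A := ⟨0, fun t ht => ht.1.1⟩
  have hsA : s ∈ A := by
    refine ⟨⟨hs, le_rfl⟩, ?_⟩
    simp only [hg, hh, max_eq_left hs, sub_self]
    rw [hψΦ 0 le_rfl p hq, Φ.map_zero]
  have htA : sInf A ∈ A := hAc.csInf_mem ⟨s, hsA⟩ hAb
  set t := sInf A with ht
  rcases htA.1.1.eq_or_lt with h0 | h0
  · have h1 := htA.2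
    rw [← h0] at h1
    simpa only [hg, hh, max_self, Φ.map_zero, zero_sub] using h1
  exfalso
  have ev : ∀ᶠ u in 𝓝[<] t, u < t ∧ 0 < u ∧ t - T < u ∧ g u ∈ closedBall (h t) δ ∧
      h u ∈ closedBall (h t) δ := by
    have e1 : ∀ᶠ u in 𝓝 t, g u ∈ closedBall (h t) δ :=
      hgc.continuousAt (htA.2 ▸ closedBall_mem_nhds _ hδ)
    have e2 : ∀ᶠ u in 𝓝 t, h u ∈ closedBall (h t) δ :=
      hhc.continuousAt (closedBall_mem_nhds _ hδ)
    filter_upwards [self_mem_nhdsWithin, nhdsWithin_le_nhds (eventually_gt_nhds h0),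
      nhdsWithin_le_nhds (eventually_gt_nhds (sub_lt_self t hT)), nhdsWithin_le_nhds e1,
      nhdsWithin_le_nhds e2] with u h1 h2 h3 h4 h5 using ⟨h1, h2, h3, h4, h5⟩
  obtain ⟨u, hut, hu0, huT, hgu, hhu⟩ := ev.exists
  have hgt : Φ.toFun (t - u) (g u) = g t := by
    simp only [hg, max_eq_left hu0.le, max_eq_left h0.le]
    rw [← Φ.map_add _ _ (sub_nonneg.mpr hut.le) hu0.le, sub_add_cancel]
  have hht : Φ.toFun (t - u) (h u) = h t := by
    simp only [hh]
    rw [← hψΦ _ (sub_nonneg.mpr hut.le) _ (hψK _ _ hq), hψadd _ _ _ hq]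
    congr 1
    ring
  have hΦT : ∀ w, Φ.toFun T w = Φ.toFun (T - (t - u)) (Φ.toFun (t - u) w) := fun w => by
    rw [← Φ.map_add _ _ (by linarith) (by linarith), sub_add_cancel]
  have hguh : g u = h u := hinj (h t) (hψK _ _ hq) _ hgu _ hhu <| by
    rw [hΦT, hΦT (h u), hgt, hht, htA.2]
  exact absurd (csInf_le hAb ⟨⟨hu0.le, hut.le.trans htA.1.2⟩, hguh⟩) (not_le.mpr hut)

/-- An orbit attracted by a compact set near which the semiflow is expanding eventually lies in
that set. -/
theorem eventually_mem_of_expanding (hψ : IsFlowExtensionOn Φ ψ K) (hne : K.Nonempty)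
    (hK : IsCompact K) (hexp : ∀ z ∈ K, ∃ τ, 0 ≤ τ ∧ ∃ r > 0, ∀ p ∈ ball z r, ∀ q ∈ ball z r,
      2 * ‖p - q‖ ≤ ‖Φ.toFun τ p - Φ.toFun τ q‖) {x : X}
    (hattr : ∀ ε, 0 < ε → ∃ t₀, 0 ≤ t₀ ∧ ∀ t, t₀ ≤ t → infDist (Φ.toFun t x) K < ε) :
    ∃ t₀, 0 ≤ t₀ ∧ ∀ t, t₀ ≤ t → Φ.toFun t x ∈ K := by
  have hinv := hψ.invariant
  obtain ⟨hψΦ, hψK, hψadd, hψc⟩ := hψ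
  have hdouble : ∀ z : K, ∃ τ, 0 ≤ τ ∧ ∃ r > 0, ∀ p ∈ ball (z : X) r,
      2 * infDist p K ≤ infDist (Φ.toFun τ p) K := by
    rintro ⟨z, hz⟩
    obtain ⟨τ, hτ, r, hr, hexpz⟩ := hexp z hz
    have hz' := hinv.apply_mem hτ hz
    have hback : ContinuousWithinAt (ψ (-τ)) K (Φ.toFun τ z) := by
      have hc : ContinuousOn (ψ (-τ)) K := hψc.comp
        (by fun_prop : Continuous fun w : X => (-τ, w)).continuousOn fun w hw => ⟨mem_univ _, hw⟩
      exact hc _ hz'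
    have hback0 : ψ (-τ) (Φ.toFun τ z) = z := by
      rw [← hψΦ τ hτ z hz, hψadd _ _ z hz, neg_add_cancel, hψΦ 0 le_rfl z hz, Φ.map_zero]
    obtain ⟨σ, hσ, hσr⟩ := Metric.continuousWithinAt_iff.mp hback r hr
    rw [hback0] at hσr
    obtain ⟨ρ, hρ, hρσ⟩ := Metric.continuousAt_iff.mp (Φ.continuous_apply hτ).continuousAt
      (σ / 2) (half_pos hσ)
    refine ⟨τ, hτ, min ρ r, lt_min hρ hr, fun p hp => ?_⟩
    have hp1 : dist (Φ.toFun τ p) (Φ.toFun τ z) < σ / 2 :=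
      hρσ ((mem_ball.mp hp).trans_le (min_le_left _ _))
    obtain ⟨w, hw, hwd⟩ := hK.exists_infDist_eq_dist hne (Φ.toFun τ p)
    have hle : dist (Φ.toFun τ p) w ≤ dist (Φ.toFun τ p) (Φ.toFun τ z) :=
      hwd ▸ infDist_le_dist_of_mem hz'
    have hwσ : dist w (Φ.toFun τ z) < σ := by
      linarith [dist_triangle_left w (Φ.toFun τ z) (Φ.toFun τ p)]
    have hΦw : Φ.toFun τ (ψ (-τ) w) = w := by
      rw [← hψΦ τ hτ _ (hψK _ w hw), hψadd _ _ w hw, add_neg_cancel, hψΦ 0 le_rfl w hw, Φ.map_zero]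
    have h := hexpz p (ball_subset_ball (min_le_right _ _) hp) _ (hσr hw hwσ)
    rw [hΦw, ← dist_eq_norm, ← dist_eq_norm, ← hwd] at h
    exact (mul_le_mul_of_nonneg_left (infDist_le_dist_of_mem (hψK _ w hw)) two_pos.le).trans h
  choose τ hτ r hr hd using hdouble
  obtain ⟨ε, hε, hleb⟩ := lebesgue_number_lemma_of_metric hK (c := fun z : K => ball (z : X) (r z))
    (fun z => isOpen_ball) fun z hz => mem_iUnion.mpr ⟨⟨z, hz⟩, mem_ball_self (hr _)⟩
  obtain ⟨t₀, ht₀, hnear⟩ := hattr ε hε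
  refine ⟨t₀, ht₀, fun t ht => ?_⟩
  have hle : infDist (Φ.toFun t x) K ≤ 0 := by
    refine nonpos_of_doubling (g := fun t => infDist (Φ.toFun t x) K)
      (fun t ht => (hnear t ht).le) (fun t ht => ?_) ht
    obtain ⟨z, hz, hzd⟩ := (infDist_lt_iff hne).mp (hnear t ht)
    obtain ⟨w, hw⟩ := hleb z hz
    refine ⟨τ w, hτ w, ?_⟩
    rw [add_comm, Φ.map_add _ _ (hτ w) (ht₀.trans ht)]
    exact hd w _ (hw hzd)
  exact (hK.isClosed.mem_iff_infDist_zero hne).mpr (hle.antisymm infDist_nonneg)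

end Merging

theorem eq_univ_of_zero_mem_interior {C : Set X} (hC : ∀ (t : ℝ) (v : X), v ∈ C → t • v ∈ C)
    (h0 : (0 : X) ∈ interior C) : C = univ := by
  refine eq_univ_of_forall fun v => ?_
  have ht : Tendsto (fun t : ℝ => t • v) (𝓝[≠] 0) (𝓝 0) := by
    have h : Continuous fun t : ℝ => t • v := by fun_prop
    simpa using (h.tendsto 0).mono_left (nhdsWithin_le_nhds (s := {0}ᶜ))
  obtain ⟨t, htC, ht0⟩ :=
    ((ht.eventually (mem_interior_iff_mem_nhds.mp h0)).and self_mem_nhdsWithin).exists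
  simpa [smul_smul, inv_mul_cancel₀ (show t ≠ 0 from ht0)] using hC t⁻¹ _ htC

end Instability

/-- **Instability lemma (Lemma 3.5).** If `ω(x)` is nonempty and compact, carries a
`k`-exponential separation associated with `C`, and the `k`-Lyapunov exponent is
positive at every point of `ω(x)`, then there is `δ'' > 0` such that for every
`y ∼ x`, `y ≠ x`, `limsup_{t→∞} ‖Φ_t(y) − Φ_t(x)‖ ≥ δ''` (stated as: for every `s`
there is `t ≥ s` with `‖Φ_t(y) − Φ_t(x)‖ ≥ δ''`). -/
theorem instability_lemma
    {X : Type*} [NormedAddCommGroup X] [NormedSpace ℝ X] [CompleteSpace X]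
    (Φ : Semiflow X) (DΦ : ℝ → X → X →L[ℝ] X) (C : Set X) (k : ℕ) (hk : 1 ≤ k)
    (hSA : StandingAssumptions Φ DΦ C k)
    (hSFM : StronglyFocusingMonotone Φ DΦ C)
    (x : X) (hωne : (omegaSet Φ x).Nonempty) (hωcomp : IsCompact (omegaSet Φ x))
    (Ep Fp : X → Submodule ℝ X)
    (hsep : KExpSeparation Φ DΦ C k (omegaSet Φ x) Ep Fp)
    (hLyap : ∀ z ∈ omegaSet Φ x, 0 < kLyap DΦ Ep z) :
    ∃ δ'' : ℝ, 0 < δ'' ∧ ∀ y : X, y - x ∈ C → y ≠ x →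
      ∀ s : ℝ, ∃ t, s ≤ t ∧ δ'' ≤ ‖Φ.toFun t y - Φ.toFun t x‖ := by
  obtain ⟨⟨-, hCsmul, -, -⟩, -, -, hcompact, hflow⟩ := hSA
  obtain ⟨hder, hcont, ⟨hmono, hsmono⟩, -, hfoc⟩ := hSFM
  obtain ⟨hbundle, hmap, hcone, ⟨P, hPcont, hP⟩, -⟩ := hsep
  obtain ⟨ψ, hψ⟩ := hflow x
  set K := omegaSet Φ x with hKdef
  have hinv : Invariant Φ K := hψ.invariant
  have hattr : ∀ ε, 0 < ε → ∃ t₀, 0 ≤ t₀ ∧ ∀ t, t₀ ≤ t → infDist (Φ.toFun t x) K < ε :=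
    fun ε hε => exists_forall_infDist_omegaSet_lt (hder 1 zero_le_one) (hcont 1 zero_le_one)
      (hcompact 1 one_pos) hωne hinv hωcomp hε
  obtain ⟨δ, hδ, T, hT, κ, hκ, hfocus⟩ := hfoc K hωcomp hinv
  have hPF : ∀ z ∈ K, ∀ v, v - P z v ∈ Fp z := fun z hz =>
    sub_apply_mem_of_isCompl (hbundle z hz).2.2.2 (hP z hz).2.1 (hP z hz).2.2
  obtain ⟨B, hB, hPB⟩ : ∃ B > 0, ∀ p ∈ K, ‖P p‖ ≤ B := by
    obtain ⟨B, hB⟩ := hωcomp.exists_bound_of_continuousOn hPcont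
    exact ⟨max B 1, by positivity, fun p hp => (hB p hp).trans (le_max_left _ _)⟩
  have hc : 0 < min κ 1 := lt_min hκ one_pos
  have hexp := fun z (hz : z ∈ K) => exists_expanding_ball hder hcont hinv
    (fun p hp => (hbundle p hp).2.2.2) hmap hP hB hPB hc hz (hLyap z hz)
  have hne : ∀ y, y - x ∈ C → y ≠ x → ∀ t, 0 ≤ t → Φ.toFun t y ≠ Φ.toFun t x := by
    intro y hyC hyx t ht hmerge
    by_cases h0 : (0 : X) ∈ interior C
    · have hCuniv := eq_univ_of_zero_mem_interior hCsmul h0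
      have hPid : ∀ z ∈ K, ∀ v, P z v = v := by
        intro z hz v
        have h : v - P z v ∈ (Fp z : Set X) ∩ C := ⟨hPF z hz v, hCuniv ▸ mem_univ _⟩
        rw [(hcone z hz).2] at h
        exact (sub_eq_zero.mp h).symm
      obtain ⟨t₀, ht₀, hmem⟩ := eventually_mem_of_expanding hψ hωne hωcomp (fun z hz => by
        obtain ⟨τ, hτ, r, hr, h⟩ := hexp z hz
        refine ⟨τ, hτ, r, hr, fun p hp q hq => h p hp q hq ?_⟩
        rw [hPid z hz]
        exact mul_le_of_le_one_left (norm_nonneg _) (min_le_right _ _)) hattr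
      have hinj : ∀ z ∈ K, ∀ p ∈ closedBall z δ, ∀ q ∈ closedBall z δ,
          Φ.toFun T p = Φ.toFun T q → p = q := by
        intro z hz p hp q hq hpq
        obtain ⟨R, hR, hRpq⟩ := hfocus z hz p hp q hq
        by_contra hpq'
        exact hR.1 _ (hCuniv ▸ mem_univ _) (sub_ne_zero.mpr hpq') (hRpq.trans (sub_eq_zero.mpr hpq))
      have hs : 0 ≤ t₀ + t := by positivity
      have hmerge' : Φ.toFun (t₀ + t) y = Φ.toFun (t₀ + t) x := by
        rw [Φ.map_add _ _ ht₀ ht, Φ.map_add _ _ ht₀ ht, hmerge]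
      have hxK : Φ.toFun (t₀ + t) x ∈ K := hmem _ (by linarith)
      have hx := eq_flow_neg_of_apply_mem hψ hδ hT hinj hs hxK
      have hy := eq_flow_neg_of_apply_mem hψ hδ hT hinj hs (hmerge'.symm ▸ hxK)
      rw [hmerge', ← hx] at hy
      exact hyx hy
    · rcases ht.eq_or_lt with rfl | ht
      · rw [Φ.map_zero, Φ.map_zero] at hmerge
        exact hyx hmerge
      · have h := hsmono t ht y x hyC hyx
        rw [hmerge, sub_self] at h
        exact h0 h
  have hexp' := fun z : K => hexp z z.2
  choose τ hτ r hr hd using hexp'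
  obtain ⟨ε, hε, hleb⟩ := lebesgue_number_lemma_of_metric hωcomp
    (c := fun z : K => ball (z : X) (r z)) (fun z => isOpen_ball)
    fun z hz => mem_iUnion.mpr ⟨⟨z, hz⟩, mem_ball_self (hr _)⟩
  set η := min (ε / 2) (δ / 2) with hη
  have hηpos : 0 < η := lt_min (half_pos hε) (half_pos hδ)
  have hηε : η ≤ ε / 2 := min_le_left _ _
  have hηδ : η ≤ δ / 2 := min_le_right _ _
  refine ⟨η, hηpos, fun y hyC hyx s => ?_⟩
  by_contra! hclose
  obtain ⟨t₀, ht₀, hnear⟩ := hattr η hηpos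
  have hnear' : ∀ t, t₀ ≤ t → s ≤ t → ∃ z ∈ K, dist (Φ.toFun t x) z < η ∧
      dist (Φ.toFun t y) z < 2 * η := by
    intro t ht hst
    obtain ⟨z, hz, hzd⟩ := (infDist_lt_iff hωne).mp (hnear t ht)
    have h := hclose t hst
    rw [← dist_eq_norm] at h
    exact ⟨z, hz, hzd, by linarith [dist_triangle (Φ.toFun t y) (Φ.toFun t x) z]⟩
  have hdeep : ∀ t, max t₀ s + T ≤ t → ∀ z ∈ K, min κ 1 * ‖Φ.toFun t y - Φ.toFun t x‖ ≤
      ‖P z (Φ.toFun t y - Φ.toFun t x)‖ := by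
    intro t ht z hz
    have h1 : t₀ ≤ t - T := by linarith [le_max_left t₀ s]
    have h2 : s ≤ t - T := by linarith [le_max_right t₀ s]
    obtain ⟨w, hw, hxw, hyw⟩ := hnear' (t - T) h1 h2
    obtain ⟨R, hR, hRv⟩ := hfocus w hw _ (mem_closedBall.mpr (by linarith : _ ≤ δ)) _
      (mem_closedBall.mpr (by linarith : dist (Φ.toFun (t - T) x) w ≤ δ))
    have h := hR.mul_norm_le hCsmul (hcone z hz).2 (hPF z hz) (hmono (t - T) (ht₀.trans h1) y x hyC)
    rwa [hRv, ← Φ.map_add _ _ hT.le (ht₀.trans h1), ← Φ.map_add _ _ hT.le (ht₀.trans h1),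
      add_sub_cancel] at h
  have hle := nonpos_of_doubling (g := fun t => ‖Φ.toFun t y - Φ.toFun t x‖)
    (t₀ := max t₀ s + T) (b := η)
    (fun t ht => (hclose t (by linarith [le_max_right t₀ s])).le) (fun t ht => by
      have h1 : t₀ ≤ t := by linarith [le_max_left t₀ s]
      have h2 : s ≤ t := by linarith [le_max_right t₀ s]
      obtain ⟨z, hz, hxz, hyz⟩ := hnear' t h1 h2
      obtain ⟨w, hw⟩ := hleb z hz
      refine ⟨τ w, hτ w, ?_⟩
      rw [add_comm t, Φ.map_add _ _ (hτ w) (ht₀.trans h1), Φ.map_add _ _ (hτ w) (ht₀.trans h1)]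
      exact hd w _ (hw (mem_ball.mpr (by linarith))) _ (hw (mem_ball.mpr (by linarith)))
        (hdeep t ht w w.2)) le_rfl
  have h0 : 0 ≤ max t₀ s + T := by linarith [le_max_left t₀ s]
  exact hne y hyC hyx _ h0 (sub_eq_zero.mp (norm_le_zero_iff.mp hle))
end

section
/- Positivity of the k-Lyapunov exponents in case (b) (intermediate claim in the proof of Lemma 4.1): Let Φ be a semiflow on X strongly focusing monotone with respect to the k-cone C, satisfying the standing assumptions, let O⁺(x) be a precompact pseudo-ordered semiorbit, and suppose ω(x) ⊆ E and ω(x) is unordered. Let ω(x)×(E_q), ω(x)×(F_q) be the bundles of a k-exponential separation along ω(x) associated with C, and for q ∈ ω(x) let α_q < β_q be exponents as in Lemma 3.3(iii), i.e. ‖D_qΦ_t|_{F_q}‖ < M_{1,q}e^{α_q t} and ‖(D_qΦ_t|_{E_q})^{−1}‖ < M_{2,q}e^{−β_q t} for all t ≥ 0. Then for every q ∈ ω(x) one has α_q ≥ 0, hence β_q > 0, and consequently the k-Lyapunov exponent satisfies λ_{kq} ≥ β_q > 0 for every q ∈ ω(x). -/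
open Set Metric Filter

section Auxiliary

variable {X : Type*} [NormedAddCommGroup X] [NormedSpace ℝ X]

/-- The ω-limit set of a precompact semiorbit meets every sphere around one of its points that
separates this point from another point of the ω-limit set. -/
lemma exists_mem_omegaSet_dist_eq (Φ : Semiflow X) {x p q : X}
    (hpre : IsCompact (closure (posOrbit Φ x))) (hp : p ∈ omegaSet Φ x) (hq : q ∈ omegaSet Φ x)
    {r : ℝ} (hr : 0 < r) (hrp : r < dist p q) : ∃ z ∈ omegaSet Φ x, dist z q = r := by
  have hcont : ContinuousOn (fun t : ℝ => dist (Φ.toFun t x) q) (Set.Ici 0) := by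
    refine (continuous_id.dist continuous_const).comp_continuousOn ?_
    exact Φ.cont.comp (f := fun t : ℝ => (t, x)) (by fun_prop) fun t ht => ⟨ht, Set.mem_univ x⟩
  have hcross : ∀ n : ℕ, ∃ t : ℝ, (n : ℝ) ≤ t ∧ dist (Φ.toFun t x) q = r := by
    intro n
    have hmem : ∀ y ∈ omegaSet Φ x, y ∈ closure {y | ∃ t, (n : ℝ) ≤ t ∧ y = Φ.toFun t x} :=
      fun y hy => Set.mem_iInter₂.1 hy (n : ℝ) (Set.mem_Ici.2 n.cast_nonneg)
    obtain ⟨_, ⟨t₁, ht₁, rfl⟩, h₁⟩ := Metric.mem_closure_iff.1 (hmem q hq) r hr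
    obtain ⟨_, ⟨t₂, ht₂, rfl⟩, h₂⟩ :=
      Metric.mem_closure_iff.1 (hmem p hp) (dist p q - r) (by linarith)
    have htri := dist_triangle p (Φ.toFun t₂ x) q
    obtain ⟨t, ht, hrt⟩ := isPreconnected_Ici.intermediate_value (s := Set.Ici (n : ℝ))
      ht₁ ht₂ (hcont.mono (Set.Ici_subset_Ici.2 n.cast_nonneg))
      (show r ∈ Set.Icc _ _ from ⟨by rw [dist_comm]; exact h₁.le, by linarith⟩)
    exact ⟨t, ht, hrt⟩
  choose t ht hrt using hcross
  obtain ⟨z, -, φ, hφ, hz⟩ := hpre.tendsto_subseq (x := fun n => Φ.toFun (t n) x)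
    fun n => subset_closure ⟨t n, n.cast_nonneg.trans (ht n), rfl⟩
  refine ⟨z, Set.mem_iInter₂.2 fun s _ => ?_, ?_⟩
  · refine mem_closure_of_tendsto hz ?_
    filter_upwards [(tendsto_natCast_atTop_atTop.comp hφ.tendsto_atTop).eventually_ge_atTop s]
      with n hn
    exact ⟨t (φ n), hn.trans (ht (φ n)), rfl⟩
  · exact tendsto_nhds_unique (hz.dist tendsto_const_nhds) (by simp [hrt])

/-- If fixed points of `f` converge to the fixed point `q`, then the normalized differences are almost
fixed by the derivative of `f` at `q`. -/
lemma tendsto_sub_fderiv_normalized {f : X → X} {f' : X →L[ℝ] X} {q : X} {u : ℕ → X}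
    (hf : HasFDerivAt f f' q) (hq : f q = q) (hu : ∀ n, f (u n) = u n)
    (hlim : Tendsto u atTop (nhds q)) :
    Tendsto (fun n => ‖u n - q‖⁻¹ • (u n - q) - f' (‖u n - q‖⁻¹ • (u n - q)))
      atTop (nhds 0) := by
  have h := (hasFDerivAt_iff_tendsto.1 hf).comp hlim
  refine squeeze_zero_norm (fun n => le_of_eq ?_) h
  simp only [Function.comp_apply, hu n, hq]
  rw [map_smul, ← smul_sub, norm_smul, norm_inv, norm_norm]

/-- At an accumulation point `q` of equilibria at which the differences avoid `C`, the linearized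
semiflow has a unit fixed vector outside `interior C`. -/
lemma exists_unit_fixed_vector {Φ : Semiflow X} {DΦ : ℝ → X → X →L[ℝ] X} {C : Set X}
    (hsmul : ∀ (t : ℝ) (v : X), v ∈ C → t • v ∈ C)
    (hD : ∀ t, 0 ≤ t → ∀ x : X, HasFDerivAt (Φ.toFun t) (DΦ t x) x)
    {q : X} (hcomp : IsCompactOperator ⇑(DΦ 1 q)) (hq : q ∈ equilibria Φ) {u : ℕ → X}
    (hu : ∀ n, u n ∈ equilibria Φ) (hne : ∀ n, u n ≠ q) (huC : ∀ n, u n - q ∉ C)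
    (hlim : Tendsto u atTop (nhds q)) :
    ∃ v : X, ‖v‖ = 1 ∧ v ∉ interior C ∧ ∀ t, 0 ≤ t → DΦ t q v = v := by
  set w : ℕ → X := fun n => ‖u n - q‖⁻¹ • (u n - q) with hw
  have hpos : ∀ n, 0 < ‖u n - q‖ := fun n => norm_pos_iff.2 (sub_ne_zero.2 (hne n))
  have hnorm : ∀ n, ‖w n‖ = 1 := fun n => by
    rw [hw]
    simp only [norm_smul, norm_inv, norm_norm]
    exact inv_mul_cancel₀ (hpos n).ne'
  have hwC : ∀ n, w n ∉ C := fun n hn => huC n <| by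
    simpa [hw, smul_smul, (hpos n).ne'] using hsmul ‖u n - q‖ _ hn
  have hfix : ∀ t, 0 ≤ t → Tendsto (fun n => w n - DΦ t q (w n)) atTop (nhds 0) :=
    fun t ht => tendsto_sub_fderiv_normalized (hD t ht q) (hq t ht) (fun n => hu n t ht) hlim
  obtain ⟨v, -, φ, hφ, hv⟩ :=
    (hcomp.isCompact_closure_image_closedBall 1).tendsto_subseq (x := fun n => DΦ 1 q (w n))
      fun n => subset_closure ⟨w n, by simp [hnorm n], rfl⟩
  have hwv : Tendsto (w ∘ φ) atTop (nhds v) := by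
    simpa [Function.comp_def] using ((hfix 1 zero_le_one).comp hφ.tendsto_atTop).add hv
  refine ⟨v, tendsto_nhds_unique hwv.norm (by simp [hnorm]), fun hvC => ?_, fun t ht => ?_⟩
  · obtain ⟨n, hn⟩ := (hwv.eventually (isOpen_interior.mem_nhds hvC)).exists
    exact hwC _ (interior_subset hn)
  · have h₁ := (hfix t ht).comp hφ.tendsto_atTop
    have h₂ := hwv.sub (((DΦ t q).continuous.tendsto v).comp hwv)
    exact (sub_eq_zero.1 (tendsto_nhds_unique h₂ h₁)).symm

/-- The linearization along an equilibrium is a semigroup. -/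
lemma linearization_add {Φ : Semiflow X} {DΦ : ℝ → X → X →L[ℝ] X}
    (hD : ∀ t, 0 ≤ t → ∀ x : X, HasFDerivAt (Φ.toFun t) (DΦ t x) x)
    {q : X} (hq : q ∈ equilibria Φ) {s t : ℝ} (hs : 0 ≤ s) (ht : 0 ≤ t) (v : X) :
    DΦ (s + t) q v = DΦ s q (DΦ t q v) := by
  have h₁ : HasFDerivAt (Φ.toFun s) (DΦ s q) (Φ.toFun t q) := by
    rw [hq t ht]; exact hD s hs q
  have h₂ := h₁.comp q (hD t ht q)
  rw [show Φ.toFun s ∘ Φ.toFun t = Φ.toFun (s + t) from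
    funext fun y => (Φ.map_add s t hs ht y).symm] at h₂
  rw [(hD (s + t) (add_nonneg hs ht) q).unique h₂]
  rfl

/-- At an equilibrium, the linearization at integer times grows at most geometrically. -/
lemma norm_linearization_natCast_le {Φ : Semiflow X} {DΦ : ℝ → X → X →L[ℝ] X}
    (hD : ∀ t, 0 ≤ t → ∀ x : X, HasFDerivAt (Φ.toFun t) (DΦ t x) x)
    {q : X} (hq : q ∈ equilibria Φ) {L : ℝ} (hL0 : 0 ≤ L) (hL : ‖DΦ 1 q‖ ≤ L) (v : X) (n : ℕ) :
    ‖DΦ n q v‖ ≤ L ^ n * ‖v‖ := by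
  induction n with
  | zero =>
    have h0 : HasFDerivAt (Φ.toFun 0) (ContinuousLinearMap.id ℝ X) q := by
      rw [show Φ.toFun 0 = id from funext Φ.map_zero]; exact hasFDerivAt_id q
    simp [(hD 0 le_rfl q).unique h0]
  | succ n ih =>
    rw [Nat.cast_succ, add_comm, linearization_add hD hq zero_le_one n.cast_nonneg, pow_succ',
      mul_assoc]
    exact ((DΦ 1 q).le_of_opNorm_le hL _).trans (by gcongr)

/-- A strict bound on unit vectors of a subspace gives a homogeneous bound on the subspace. -/
lemma mul_norm_le_of_unit {A : X →L[ℝ] X} {E : Submodule ℝ X} {c : ℝ}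
    (h : ∀ v ∈ E, ‖v‖ = 1 → c < ‖A v‖) {v : X} (hv : v ∈ E) : c * ‖v‖ ≤ ‖A v‖ := by
  rcases eq_or_ne v 0 with rfl | hv0
  · simp
  have hpos : 0 < ‖v‖ := norm_pos_iff.2 hv0
  have h₁ := h (‖v‖⁻¹ • v) (E.smul_mem _ hv) (by simp [norm_smul, hpos.ne'])
  rw [map_smul, norm_smul, norm_inv, norm_norm] at h₁
  calc c * ‖v‖ ≤ ‖v‖⁻¹ * ‖A v‖ * ‖v‖ := by gcongr
    _ = ‖A v‖ := by field_simp

/-- At an equilibrium, an exponential lower bound with positive rate `b` on an invariant nonzero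
subspace bounds the `k`-Lyapunov exponent from below. -/
lemma le_kLyap_of_lower_bound {Φ : Semiflow X} {DΦ : ℝ → X → X →L[ℝ] X}
    (hD : ∀ t, 0 ≤ t → ∀ x : X, HasFDerivAt (Φ.toFun t) (DΦ t x) x)
    {q : X} (hq : q ∈ equilibria Φ) {Ep : X → Submodule ℝ X}
    (hinv : ∀ t, 0 ≤ t → ∀ v ∈ Ep q, DΦ t q v ∈ Ep q) {e : X} (he : e ∈ Ep q) (he1 : ‖e‖ = 1)
    {b M : ℝ} (hb : 0 ≤ b) (hM : 1 ≤ M)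
    (hlow : ∀ t, 0 ≤ t → ∀ v ∈ Ep q, ‖v‖ = 1 → M⁻¹ * Real.exp (b * t) < ‖DΦ t q v‖) :
    b ≤ kLyap DΦ Ep q := by
  have hM0 : 0 < M := zero_lt_one.trans_le hM
  have hlow' : ∀ t, 0 ≤ t → M⁻¹ * Real.exp (b * t) ≤ infNorm (DΦ t q) (Ep q) := by
    intro t ht
    refine le_csInf ⟨_, e, he, he1, rfl⟩ ?_
    rintro _ ⟨v, hv, hv1, rfl⟩
    exact (hlow t ht v hv hv1).le
  set L : ℝ := max ‖DΦ 1 q‖ 1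
  have hL1 : 1 ≤ L := le_max_right _ _
  have hup : ∀ t, 0 ≤ t → infNorm (DΦ t q) (Ep q) ≤ M * L ^ ⌈t⌉₊ := by
    intro t ht
    have h₁ : infNorm (DΦ t q) (Ep q) ≤ ‖DΦ t q e‖ := by
      refine csInf_le ⟨0, ?_⟩ ⟨e, he, he1, rfl⟩
      rintro _ ⟨v, -, -, rfl⟩
      exact norm_nonneg _
    have hs : 0 ≤ (⌈t⌉₊ : ℝ) - t := sub_nonneg.2 (Nat.le_ceil t)
    have h₂ := mul_norm_le_of_unit (hlow _ hs) (hinv t ht e he)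
    rw [← linearization_add hD hq hs ht, sub_add_cancel] at h₂
    have h₃ := norm_linearization_natCast_le hD hq (zero_le_one.trans hL1) (le_max_left _ _) e ⌈t⌉₊
    rw [he1, mul_one] at h₃
    have h₄ : M⁻¹ * ‖DΦ t q e‖ ≤ M⁻¹ * Real.exp (b * (⌈t⌉₊ - t)) * ‖DΦ t q e‖ := by
      gcongr
      exact le_mul_of_one_le_right (by positivity) (Real.one_le_exp (by positivity))
    calc infNorm (DΦ t q) (Ep q) ≤ ‖DΦ t q e‖ := h₁
      _ = M * (M⁻¹ * ‖DΦ t q e‖) := by field_simp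
      _ ≤ M * L ^ ⌈t⌉₊ := by gcongr; exact h₄.trans (h₂.trans h₃)
  have hlogL : 0 ≤ Real.log L := Real.log_nonneg hL1
  have hlogM : 0 ≤ Real.log M := Real.log_nonneg hM
  have hbdd : IsBoundedUnder (· ≤ ·) atTop
      fun t : ℝ => Real.log (infNorm (DΦ t q) (Ep q)) / t := by
    refine isBoundedUnder_of_eventually_le (a := Real.log M + 2 * Real.log L) ?_
    filter_upwards [eventually_ge_atTop (1 : ℝ)] with t ht
    have ht0 : 0 ≤ t := zero_le_one.trans ht
    have hpos : 0 < infNorm (DΦ t q) (Ep q) := lt_of_lt_of_le (by positivity) (hlow' t ht0)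
    have h := Real.log_le_log hpos (hup t ht0)
    rw [Real.log_mul hM0.ne' (by positivity), Real.log_pow] at h
    have hc : (⌈t⌉₊ : ℝ) ≤ t + 1 := (Nat.ceil_lt_add_one ht0).le
    rw [div_le_iff₀ (by linarith)]
    nlinarith [mul_le_mul_of_nonneg_right hc hlogL, mul_nonneg hlogM (sub_nonneg.2 ht),
      mul_nonneg hlogL (sub_nonneg.2 ht)]
  have hlim : Tendsto (fun t : ℝ => -Real.log M / t + b) atTop (nhds b) := by
    simpa using (tendsto_const_nhds.div_atTop tendsto_id).add_const b
  rw [← hlim.limsup_eq]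
  refine limsup_le_limsup ?_ hlim.isCoboundedUnder_le hbdd
  filter_upwards [eventually_gt_atTop (0 : ℝ)] with t ht
  have h := Real.log_le_log (by positivity) (hlow' t ht.le)
  rw [Real.log_mul (by positivity) (Real.exp_ne_zero _), Real.log_inv, Real.log_exp] at h
  rw [le_div_iff₀ ht, add_mul, div_mul_cancel₀ _ ht.ne']
  exact h

end Auxiliary

/-- **Positivity of the `k`-Lyapunov exponents in case (b)** (intermediate claim in the
proof of Lemma 4.1). Suppose `ω(x) ⊆ E` is unordered, and the `k`-exponential separation
along `ω(x)` carries exponents `α_q < β_q` with the bounds of Lemma 3.3(iii). Then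
`α_q ≥ 0`, hence `β_q > 0`, and `λ_{kq} ≥ β_q > 0` for every `q ∈ ω(x)`. -/
theorem lyapunov_positive_case_b
    {X : Type*} [NormedAddCommGroup X] [NormedSpace ℝ X] [CompleteSpace X]
    (Φ : Semiflow X) (DΦ : ℝ → X → X →L[ℝ] X) (C : Set X) (k : ℕ) (hk : 1 ≤ k)
    (hSA : StandingAssumptions Φ DΦ C k)
    (hSFM : StronglyFocusingMonotone Φ DΦ C)
    (x : X) (hpre : IsCompact (closure (posOrbit Φ x)))
    (hpo : PseudoOrdered Φ C x)
    (hωE : omegaSet Φ x ⊆ equilibria Φ) (hunord : UnorderedSet C (omegaSet Φ x))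
    (Ep Fp : X → Submodule ℝ X)
    (hsep : KExpSeparation Φ DΦ C k (omegaSet Φ x) Ep Fp)
    (a b M1 M2 : X → ℝ)
    (hexp : ∀ q ∈ omegaSet Φ x, 1 < M1 q ∧ 1 < M2 q ∧ a q < b q ∧
      (∀ t, 0 ≤ t → ∀ v ∈ Fp q, ‖v‖ = 1 →
        ‖DΦ t q v‖ < M1 q * Real.exp (a q * t)) ∧
      (∀ t, 0 ≤ t → ∀ v ∈ Ep q, ‖v‖ = 1 →
        (M2 q)⁻¹ * Real.exp (b q * t) < ‖DΦ t q v‖)) :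
    ∀ q ∈ omegaSet Φ x, 0 ≤ a q ∧ 0 < b q ∧ b q ≤ kLyap DΦ Ep q := by
  obtain ⟨⟨-, hsmul, -, -⟩, -, -, hcomp, -⟩ := hSA
  obtain ⟨hD, -⟩ := hSFM
  obtain ⟨hbun, hinv, hcone, -, -⟩ := hsep
  intro q hq
  obtain ⟨hM1, hM2, hab, hF, hE⟩ := hexp q hq
  have hqE := hωE hq
  have hDE : ∀ t, 0 ≤ t → ∀ v ∈ Ep q, DΦ t q v ∈ Ep q := fun t ht v hv => by
    have h := (hinv q hq t ht).1
    rw [hqE t ht] at h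
    exact h ▸ Submodule.mem_map_of_mem (f := (DΦ t q : X →ₗ[ℝ] X)) hv
  have hDF : ∀ t, 0 ≤ t → ∀ v ∈ Fp q, DΦ t q v ∈ Fp q := fun t ht v hv => by
    have h := (hinv q hq t ht).2
    rw [hqE t ht] at h
    exact h (Submodule.mem_map_of_mem (f := (DΦ t q : X →ₗ[ℝ] X)) hv)
  have ha : 0 ≤ a q := by
    obtain ⟨p, hp, hpq⟩ : ∃ p ∈ omegaSet Φ x, p ≠ q := by
      by_contra! h
      exact hunord.1 ⟨q, Set.eq_singleton_iff_unique_mem.2 ⟨hq, h⟩⟩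
    have hd : 0 < dist p q := dist_pos.2 hpq
    have hsphere : ∀ n : ℕ, ∃ z ∈ omegaSet Φ x, dist z q = dist p q / (n + 2) := fun n => by
      refine exists_mem_omegaSet_dist_eq Φ hpre hp hq (by positivity) (div_lt_self hd ?_)
      linarith [n.cast_nonneg (α := ℝ)]
    choose u hu hud using hsphere
    have hne : ∀ n, u n ≠ q := fun n => dist_pos.1 (by rw [hud n]; positivity)
    have hlim : Tendsto u atTop (nhds q) := by
      rw [tendsto_iff_dist_tendsto_zero]
      simp only [hud]
      exact tendsto_const_nhds.div_atTop
        (tendsto_atTop_add_const_right _ _ tendsto_natCast_atTop_atTop)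
    obtain ⟨v, hv1, hvC, hvfix⟩ := exists_unit_fixed_vector hsmul hD (hcomp 1 one_pos q) hqE
      (fun n => hωE (hu n)) hne (fun n => hunord.2 _ (hu n) _ hq (hne n)) hlim
    have hv0 : v ≠ 0 := norm_ne_zero_iff.1 (by simp [hv1])
    obtain ⟨e, he, f, hf, hef⟩ :=
      Submodule.mem_sup.1 ((hbun q hq).2.2.2.sup_eq_top ▸ Submodule.mem_top (x := v))
    have hf0 : f ≠ 0 := by
      rintro rfl
      rw [add_zero] at hef
      subst hef
      exact hvC ((hcone q hq).1 ⟨he, hv0⟩)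
    have hffix : ∀ t, 0 ≤ t → DΦ t q f = f := fun t ht => by
      have h := hvfix t ht
      rw [← hef, map_add] at h
      have hmem : DΦ t q f - f ∈ Ep q := by
        rw [show DΦ t q f - f = e - DΦ t q e by rw [sub_eq_sub_iff_add_eq_add, add_comm, h]]
        exact (Ep q).sub_mem he (hDE t ht e he)
      exact sub_eq_zero.1 ((Submodule.disjoint_def.1 (hbun q hq).2.2.2.disjoint) _ hmem
        ((Fp q).sub_mem (hDF t ht f hf) hf))
    have hfpos : 0 < ‖f‖ := norm_pos_iff.2 hf0
    have hbound : ∀ t, 0 ≤ t → 1 ≤ M1 q * Real.exp (a q * t) := fun t ht => by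
      have hg1 : ‖‖f‖⁻¹ • f‖ = 1 := by simp [norm_smul, hfpos.ne']
      have h := hF t ht (‖f‖⁻¹ • f) ((Fp q).smul_mem _ hf) hg1
      rw [map_smul, hffix t ht, hg1] at h
      exact h.le
    by_contra! hneg
    have htend : Tendsto (fun t : ℝ => M1 q * Real.exp (a q * t)) atTop (nhds (M1 q * 0)) :=
      (Real.tendsto_exp_atBot.comp (tendsto_id.const_mul_atTop_of_neg hneg)).const_mul _
    have h := ge_of_tendsto htend ((eventually_ge_atTop 0).mono hbound)
    norm_num at h
  have hb : 0 < b q := ha.trans_lt hab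
  refine ⟨ha, hb, ?_⟩
  have hnt : Nontrivial (Ep q) := by
    rw [← rank_pos_iff_nontrivial (R := ℝ), (hbun q hq).1]
    exact_mod_cast hk
  obtain ⟨⟨e, he⟩, he1⟩ := exists_norm_eq (Ep q) zero_le_one
  exact le_kLyap_of_lower_bound hD hqE hDE he he1 hb.le hM2.le hE
end

section
/- Existence of a linearly unstable equilibrium in the α-limit set in case (c) (first assertion in the proof of Lemma 4.2): Let Φ be a semiflow on X strongly focusing monotone with respect to the k-cone C, satisfying the standing assumptions, let O⁺(x) be a precompact pseudo-ordered semiorbit, and suppose alternative (c) holds: there is an ordered invariant set B̃ ⊊ ω(x) with B̃ ∼ ω(x) and, for every z ∈ ω(x)∖B̃, α(z) ∪ ω(z) ⊆ B̃ and α(z) ⊆ E. Fix z ∈ ω(x)∖B̃ such that there exists z̃ ∈ ω(x)∖B̃ with z ⇀ z̃, and let α(z)×(E_q), α(z)×(F_q) be the bundles of a k-exponential separation along the compact invariant set α(z) ⊆ E, with exponents α_q < β_q as in Lemma 3.3(iii). Then there exists q ∈ α(z) with β_q > 0; equivalently, there exist q ∈ α(z) and t₀ > 0 such that every spectral value λ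 of D_qΦ_{t₀} restricted to E_q satisfies |λ| > 1. -/
open Set Metric Filter

section Helpers

variable {X : Type*} [NormedAddCommGroup X] [NormedSpace ℝ X]

open Topology

/-- Vectors outside `C` are controlled by their component transverse to a finite-dimensional
subspace `E` with `E \ {0} ⊆ int C`. -/
lemma exists_norm_proj_le_of_notMem_cone {C : Set X}
    (hC : ∀ (t : ℝ) (v : X), v ∈ C → t • v ∈ C) (E : Submodule ℝ X) [FiniteDimensional ℝ E]
    (hE : ((E : Set X) \ {0}) ⊆ interior C) (P : X → X) (hP : ∀ v, P v ∈ E) :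
    ∃ K : ℝ, 0 ≤ K ∧ ∀ v ∉ C, ‖P v‖ ≤ K * ‖v - P v‖ := by
  have hcomp : IsCompact ((fun e : E => (e : X)) '' sphere (0 : E) 1) :=
    (isCompact_sphere (0 : E) 1).image continuous_subtype_val
  have hsub : (fun e : E => (e : X)) '' sphere (0 : E) 1 ⊆ interior C := by
    rintro _ ⟨e, he, rfl⟩
    refine hE ⟨e.2, fun h0 => ?_⟩
    have h1 : e = 0 := Subtype.ext h0
    simp [h1] at he
  obtain ⟨ε, hε, hth⟩ := hcomp.exists_thickening_subset_open isOpen_interior hsub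
  refine ⟨ε⁻¹, by positivity, fun v hv => ?_⟩
  by_contra! hlt
  have hlt' : ‖v - P v‖ < ε * ‖P v‖ := by
    rwa [inv_mul_lt_iff₀ hε] at hlt
  have hpos : 0 < ‖P v‖ := by
    by_contra! h0
    have : ‖P v‖ = 0 := le_antisymm h0 (norm_nonneg _)
    rw [this, mul_zero] at hlt'
    exact absurd hlt' (not_lt.2 (norm_nonneg _))
  have hmem : ‖P v‖⁻¹ • v ∈ thickening ε ((fun e : E => (e : X)) '' sphere (0 : E) 1) := by
    rw [mem_thickening_iff]
    refine ⟨‖P v‖⁻¹ • P v, ⟨‖P v‖⁻¹ • (⟨P v, hP v⟩ : E), ?_, rfl⟩, ?_⟩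
    · rw [mem_sphere_zero_iff_norm, norm_smul, norm_inv, norm_norm]
      exact inv_mul_cancel₀ hpos.ne'
    · rw [dist_eq_norm, ← smul_sub, norm_smul, norm_inv, norm_norm, inv_mul_lt_iff₀ hpos]
      linarith [mul_comm ε ‖P v‖]
  have := hC ‖P v‖ _ (interior_subset (hth hmem))
  rw [smul_inv_smul₀ hpos.ne'] at this
  exact hv this

/-- If the transverse bundle is contracted at the fixed point `q`, then for a suitable time `T`
the map `φ T` does not expand the distance of nearby points with unordered images. -/
lemma exists_time_norm_sub_le_of_notMem_cone {C : Set X}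
    (hC : ∀ (t : ℝ) (v : X), v ∈ C → t • v ∈ C)
    (φ : ℝ → X → X) (Dφ : ℝ → X → X →L[ℝ] X) (q : X)
    (hD : ∀ t, 0 ≤ t → HasStrictFDerivAt (φ t) (Dφ t q) q)
    (E F : Submodule ℝ X) [FiniteDimensional ℝ E] (hEF : IsCompl E F)
    (hEinv : ∀ t, 0 ≤ t → ∀ v ∈ E, Dφ t q v ∈ E)
    (hFinv : ∀ t, 0 ≤ t → ∀ v ∈ F, Dφ t q v ∈ F)
    (hE : ((E : Set X) \ {0}) ⊆ interior C)
    (P : X →L[ℝ] X) (hPmem : ∀ v, P v ∈ E) (hPE : ∀ v ∈ E, P v = v) (hPF : ∀ v ∈ F, P v = 0)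
    {a M : ℝ} (ha : a < 0)
    (hcontr : ∀ t, 0 ≤ t → ∀ v ∈ F, ‖v‖ = 1 → ‖Dφ t q v‖ < M * Real.exp (a * t)) :
    ∃ T > (0 : ℝ), ∀ᶠ p : X × X in 𝓝 (q, q),
      φ T p.1 - φ T p.2 ∉ C → ‖φ T p.1 - φ T p.2‖ ≤ ‖p.1 - p.2‖ := by
  obtain ⟨K, hK, hcone⟩ := exists_norm_proj_le_of_notMem_cone hC E hE P hPmem
  have hQ : ∀ v, v - P v ∈ F := by
    intro v
    obtain ⟨e, he, f, hf, rfl⟩ : ∃ e ∈ E, ∃ f ∈ F, e + f = v :=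
      Submodule.mem_sup.1 (hEF.sup_eq_top ▸ Submodule.mem_top)
    rw [map_add, hPE e he, hPF f hf]
    simpa using hf
  set c : ℝ := (1 + K) * (1 + ‖P‖) with hc
  have hcpos : 0 < c := by positivity
  have htend : Tendsto (fun T : ℝ => M * Real.exp (a * T)) atTop (𝓝 0) := by
    have h1 : Tendsto (fun T : ℝ => a * T) atTop atBot :=
      tendsto_id.const_mul_atTop_of_neg ha
    simpa using (Real.tendsto_exp_atBot.comp h1).const_mul M
  obtain ⟨T, hTsmall, hT⟩ :=
    ((htend.eventually (gt_mem_nhds (show (0 : ℝ) < 1 / (2 * c) by positivity))).and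
      (eventually_gt_atTop 0)).exists
  refine ⟨T, hT, ?_⟩
  have hη : 0 < 1 / (2 * c) := by positivity
  have hstrict := (hD T hT.le).isLittleO.def hη
  filter_upwards [hstrict] with p hp hnot
  have hv := hcone _ hnot
  set u := p.1 - p.2 with hu
  set v := φ T p.1 - φ T p.2 with hvdef
  set r := v - Dφ T q u with hr
  have hF : ∀ f ∈ F, ‖Dφ T q f‖ ≤ 1 / (2 * c) * ‖f‖ := by
    intro f hf
    rcases eq_or_ne f 0 with rfl | hf0
    · simp
    have hpos : 0 < ‖f‖ := norm_pos_iff.2 hf0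
    have h1 := hcontr T hT.le (‖f‖⁻¹ • f) (F.smul_mem _ hf)
      (by rw [norm_smul, norm_inv, norm_norm, inv_mul_cancel₀ hpos.ne'])
    rw [map_smul, norm_smul, norm_inv, norm_norm, inv_mul_lt_iff₀ hpos] at h1
    nlinarith
  have hPbound : ∀ w, ‖w - P w‖ ≤ (1 + ‖P‖) * ‖w‖ := by
    intro w
    calc ‖w - P w‖ ≤ ‖w‖ + ‖P w‖ := norm_sub_le _ _
      _ ≤ ‖w‖ + ‖P‖ * ‖w‖ := by gcongr; exact P.le_opNorm w
      _ = _ := by ring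
  have hsplit : v - P v = Dφ T q (u - P u) + (r - P r) := by
    have h1 : P (Dφ T q (P u)) = Dφ T q (P u) := hPE _ (hEinv T hT.le _ (hPmem u))
    have h2 : P (Dφ T q (u - P u)) = 0 := hPF _ (hFinv T hT.le _ (hQ u))
    rw [map_sub, map_sub, h1] at h2
    have h3 : P r = P v - Dφ T q (P u) := by rw [hr, map_sub P, sub_eq_zero.1 h2]
    rw [h3, hr, map_sub (Dφ T q)]
    abel
  have htrans : ‖v - P v‖ ≤ (1 + ‖P‖) * (1 / c) * ‖u‖ := by
    rw [hsplit]
    calc _ ≤ ‖Dφ T q (u - P u)‖ + ‖r - P r‖ := norm_add_le _ _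
      _ ≤ 1 / (2 * c) * ((1 + ‖P‖) * ‖u‖) + (1 + ‖P‖) * (1 / (2 * c) * ‖u‖) := by
        gcongr
        · refine (hF _ (hQ u)).trans ?_
          gcongr
          exact hPbound u
        · refine (hPbound r).trans ?_
          gcongr
      _ = _ := by field_simp; ring
  calc ‖v‖ = ‖P v + (v - P v)‖ := by rw [add_sub_cancel]
    _ ≤ ‖P v‖ + ‖v - P v‖ := norm_add_le _ _
    _ ≤ (1 + K) * ‖v - P v‖ := by linarith
    _ ≤ (1 + K) * ((1 + ‖P‖) * (1 / c) * ‖u‖) := by gcongr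
    _ = c * (1 / c) * ‖u‖ := by rw [hc]; ring
    _ = ‖u‖ := by rw [mul_one_div_cancel hcpos.ne', one_mul]

/-- Local statements with a positive time can be made to hold with a common time range near the
diagonal of a compact set. -/
lemma IsCompact.exists_common_time_range {Y : Type*} [TopologicalSpace Y] {S : Set Y}
    (hS : IsCompact S) (Q : ℝ → Y → Prop)
    (h : ∀ q ∈ S, ∃ T > (0 : ℝ), ∀ᶠ p in 𝓝 q, Q T p) :
    ∃ τ > (0 : ℝ), ∃ T₁ : ℝ, ∀ᶠ p in 𝓝ˢ S, ∃ T, τ ≤ T ∧ T ≤ T₁ ∧ Q T p := by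
  refine hS.induction_on (p := fun S => ∃ τ > (0 : ℝ), ∃ T₁ : ℝ,
    ∀ᶠ p in 𝓝ˢ S, ∃ T, τ ≤ T ∧ T ≤ T₁ ∧ Q T p) ⟨1, one_pos, 1, by simp⟩ ?_ ?_ ?_
  · rintro s t hst ⟨τ, hτ, T₁, h⟩
    exact ⟨τ, hτ, T₁, h.filter_mono (nhdsSet_mono hst)⟩
  · rintro s t ⟨τ, hτ, T₁, h⟩ ⟨τ', hτ', T₁', h'⟩
    refine ⟨min τ τ', lt_min hτ hτ', max T₁ T₁', ?_⟩
    rw [nhdsSet_union, eventually_sup]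
    constructor
    · filter_upwards [h] with p ⟨T, h1, h2, h3⟩
      exact ⟨T, (min_le_left _ _).trans h1, h2.trans (le_max_left _ _), h3⟩
    · filter_upwards [h'] with p ⟨T, h1, h2, h3⟩
      exact ⟨T, (min_le_right _ _).trans h1, h2.trans (le_max_right _ _), h3⟩
  · intro q hq
    obtain ⟨T, hT, hev⟩ := h q hq
    obtain ⟨t, ht, hopen, hqt⟩ := eventually_nhds_iff.1 hev
    refine ⟨t, mem_nhdsWithin_of_mem_nhds (hopen.mem_nhds hqt), T, hT, T, ?_⟩
    filter_upwards [hopen.mem_nhdsSet.2 subset_rfl] with p hp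
    exact ⟨T, le_rfl, le_rfl, ht p hp⟩

/-- A positive continuous function that never increases along arbitrarily far backward steps of
bounded length does not tend to zero. -/
lemma not_tendsto_zero_of_backward_steps {g : ℝ → ℝ} (hg : Continuous g)
    (hpos : ∀ t, 0 ≤ t → 0 < g t) {τ T₁ : ℝ} (hτ : 0 < τ)
    (hstep : ∀ᶠ t in atTop, ∃ T, τ ≤ T ∧ T ≤ T₁ ∧ g (t - T) ≤ g t) :
    ¬ Tendsto g atTop (𝓝 0) := by
  intro htend
  obtain ⟨t₀, ht₀⟩ := eventually_atTop.1 hstep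
  set t₁ := max (max t₀ T₁) 0 with ht₁
  have h0 : 0 ≤ t₁ := le_max_right _ _
  have htt : t₀ ≤ t₁ := (le_max_left _ _).trans (le_max_left _ _)
  have hTt : T₁ ≤ t₁ := (le_max_right _ _).trans (le_max_left _ _)
  obtain ⟨s, hs, hmin⟩ := isCompact_Icc.exists_isMinOn (nonempty_Icc.2 h0) hg.continuousOn
  have key : ∀ n : ℕ, ∀ t, 0 ≤ t → t ≤ t₁ + n * τ → g s ≤ g t := by
    intro n
    induction n with
    | zero => exact fun t h1 h2 => hmin ⟨h1, by simpa using h2⟩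
    | succ n ih =>
      intro t h1 h2
      by_cases h3 : t ≤ t₁
      · exact hmin ⟨h1, h3⟩
      · push Not at h3
        obtain ⟨T, hT1, hT2, hT3⟩ := ht₀ t (by linarith)
        push_cast at h2
        exact (ih (t - T) (by linarith) (by linarith)).trans hT3
  have hlow : ∀ t, 0 ≤ t → g s ≤ g t := by
    intro t ht
    obtain ⟨n, hn⟩ := exists_nat_ge (t / τ)
    exact key n t ht (by rw [div_le_iff₀ hτ] at hn; linarith)
  obtain ⟨t, h1, h2⟩ :=
    ((htend.eventually (gt_mem_nhds (hpos s hs.1))).and (eventually_ge_atTop 0)).exists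
  exact absurd (hlow t h2) (not_le.2 h1)

lemma isClosed_alphaSet {X : Type*} [NormedAddCommGroup X] (ψ : ℝ → X → X) (z : X) : IsClosed (alphaSet ψ z) :=
  isClosed_biInter fun _ _ => isClosed_closure

lemma isClosed_omegaSet (Φ : Semiflow X) (x : X) : IsClosed (omegaSet Φ x) :=
  isClosed_biInter fun _ _ => isClosed_closure

lemma isCompact_omegaSet {Φ : Semiflow X} {x : X} (h : IsCompact (closure (posOrbit Φ x))) :
    IsCompact (omegaSet Φ x) :=
  h.of_isClosed_subset (isClosed_omegaSet Φ x)
    (biInter_subset_of_mem (self_mem_Ici (a := (0 : ℝ))))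

lemma alphaSet_subset {X : Type*} [NormedAddCommGroup X] {ψ : ℝ → X → X} {z : X} {S : Set X} (hS : IsClosed S)
    (h : ∀ t, ψ t z ∈ S) : alphaSet ψ z ⊆ S := by
  refine (biInter_subset_of_mem (self_mem_Ici (a := (0 : ℝ)))).trans ?_
  refine closure_minimal ?_ hS
  rintro _ ⟨t, -, rfl⟩
  exact h _

lemma mem_alphaSet_of_mapClusterPt {X : Type*} [NormedAddCommGroup X]
    {ψ : ℝ → X → X} {z q : X}
    (h : MapClusterPt q atTop fun t => ψ (-t) z) : q ∈ alphaSet ψ z := by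
  refine mem_iInter₂.2 fun s _ => ?_
  refine isClosed_closure.mem_of_mapClusterPt h ?_
  filter_upwards [eventually_ge_atTop s] with t ht
  exact subset_closure ⟨t, ht, rfl⟩

end Helpers

/-- **Existence of a linearly unstable equilibrium in the α-limit set in case (c)**
(first assertion in the proof of Lemma 4.2). Under alternative (c), fix
`z ∈ ω(x) \ B` admitting `z̃ ∈ ω(x) \ B` with `z ⇀ z̃`, and let the `k`-exponential
separation along `α(z) ⊆ E` carry exponents `α_q < β_q` as in Lemma 3.3(iii). Then some
`q ∈ α(z)` has `β_q > 0`. -/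
theorem unstable_equilibrium_in_alpha_limit
    {X : Type*} [NormedAddCommGroup X] [NormedSpace ℝ X] [CompleteSpace X]
    (Φ : Semiflow X) (DΦ : ℝ → X → X →L[ℝ] X) (C : Set X) (k : ℕ) (hk : 1 ≤ k)
    (hSA : StandingAssumptions Φ DΦ C k)
    (hSFM : StronglyFocusingMonotone Φ DΦ C)
    (x : X) (hpre : IsCompact (closure (posOrbit Φ x)))
    (hpo : PseudoOrdered Φ C x)
    (ψ : ℝ → X → X) (hψ : IsFlowExtensionOn Φ ψ (omegaSet Φ x))
    (B : Set X) (hBsub : B ⊆ omegaSet Φ x) (hBne : B ≠ omegaSet Φ x)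
    (hBord : OrderedSet C B) (hBinv : Invariant Φ B)
    (hBom : SetsOrdered C B (omegaSet Φ x))
    (hc : ∀ z ∈ omegaSet Φ x \ B,
      alphaSet ψ z ∪ omegaSet Φ z ⊆ B ∧ alphaSet ψ z ⊆ equilibria Φ)
    (z zt : X) (hz : z ∈ omegaSet Φ x \ B) (hzt : zt ∈ omegaSet Φ x \ B)
    (hunord : z - zt ∉ C)
    (Ep Fp : X → Submodule ℝ X)
    (hsep : KExpSeparation Φ DΦ C k (alphaSet ψ z) Ep Fp)
    (a b M1 M2 : X → ℝ)
    (hexp : ∀ q ∈ alphaSet ψ z, 1 < M1 q ∧ 1 < M2 q ∧ a q < b q ∧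
      (∀ t, 0 ≤ t → ∀ v ∈ Fp q, ‖v‖ = 1 →
        ‖DΦ t q v‖ < M1 q * Real.exp (a q * t)) ∧
      (∀ t, 0 ≤ t → ∀ v ∈ Ep q, ‖v‖ = 1 →
        (M2 q)⁻¹ * Real.exp (b q * t) < ‖DΦ t q v‖)) :
    ∃ q ∈ alphaSet ψ z, 0 < b q := by
  by_contra! hb
  obtain ⟨⟨-, hCsmul, ⟨W, hWC, -⟩, -⟩, -, -, -, -⟩ := hSA
  obtain ⟨hder, hdercont, hmono, -, -⟩ := hSFM
  obtain ⟨hbun, hinv, hcone, ⟨P, -, hP⟩, -⟩ := hsep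
  obtain ⟨hψΦ, hψmem, hψadd, hψcont⟩ := hψ
  have hωc := isCompact_omegaSet hpre
  have hαc : IsCompact (alphaSet ψ z) :=
    hωc.of_isClosed_subset (isClosed_alphaSet ψ z)
      (alphaSet_subset (isClosed_omegaSet Φ x) fun t => hψmem t z hz.1)
  have hforward : ∀ y ∈ omegaSet Φ x, ∀ t T : ℝ, 0 ≤ T →
      Φ.toFun T (ψ (-t) y) = ψ (-(t - T)) y := by
    intro y hy t T hT
    rw [← hψΦ T hT _ (hψmem _ y hy), hψadd _ _ y hy]
    congr 1; ring
  have hψzero : ∀ y ∈ omegaSet Φ x, ψ 0 y = y := fun y hy => by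
    rw [hψΦ 0 le_rfl y hy, Φ.map_zero]
  have hun : ∀ t, 0 ≤ t → ψ (-t) z - ψ (-t) zt ∉ C := by
    intro t ht hmem
    have h1 := hmono.1 t ht _ _ hmem
    rw [hforward z hz.1 t t ht, hforward zt hzt.1 t t ht, sub_self, neg_zero,
      hψzero z hz.1, hψzero zt hzt.1] at h1
    exact hunord h1
  have h0C : (0 : X) ∈ C := hWC W.zero_mem
  set S : Set (X × X) := (fun q => (q, q)) '' alphaSet ψ z with hS
  have hScomp : IsCompact S := hαc.image (by fun_prop)
  have htend : Tendsto (fun t : ℝ => (ψ (-t) z, ψ (-t) zt)) atTop (nhdsSet S) := by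
    intro s hs
    obtain ⟨U, hU, hSU, hUs⟩ := mem_nhdsSet_iff_exists.1 hs
    refine mem_of_superset ((hωc.prod hωc).adherence_nhdset ?_ hU ?_) hUs
    · rw [le_principal_iff]
      exact mem_map.2 <| Eventually.of_forall fun t => ⟨hψmem _ z hz.1, hψmem _ zt hzt.1⟩
    · rintro ⟨q, q'⟩ - hcl
      have hmcl : MapClusterPt (q, q') atTop fun t : ℝ => (ψ (-t) z, ψ (-t) zt) := hcl
      have hq := mem_alphaSet_of_mapClusterPt (hmcl.continuousAt_comp continuousAt_fst)
      have hq' := mem_alphaSet_of_mapClusterPt (hmcl.continuousAt_comp continuousAt_snd)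
      rcases eq_or_ne q q' with rfl | hne
      · exact hSU ⟨q, hq, rfl⟩
      have hint := hmono.2 1 one_pos q q'
        (hBord q ((hc z hz).1 (Or.inl hq)) q' ((hc zt hzt).1 (Or.inl hq'))) hne
      rw [(hc z hz).2 hq 1 zero_le_one, (hc zt hzt).2 hq' 1 zero_le_one] at hint
      have hnear : ∀ᶠ p : X × X in nhds (q, q'), p.1 - p.2 ∈ interior C :=
        (continuous_fst.sub continuous_snd).continuousAt.eventually
          (isOpen_interior.mem_nhds hint)
      obtain ⟨t, ht, ht0⟩ :=
        ((hmcl.frequently hnear).and_eventually (eventually_ge_atTop 0)).exists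
      exact absurd (interior_subset ht) (hun t ht0)
  obtain ⟨τ, hτ, T₁, hrange⟩ := hScomp.exists_common_time_range
    (fun T p => Φ.toFun T p.1 - Φ.toFun T p.2 ∉ C →
      ‖Φ.toFun T p.1 - Φ.toFun T p.2‖ ≤ ‖p.1 - p.2‖) (by
    rintro _ ⟨q, hq, rfl⟩
    obtain ⟨-, -, hab, hF, -⟩ := hexp q hq
    have hqE : ∀ t, 0 ≤ t → Φ.toFun t q = q := (hc z hz).2 hq
    obtain ⟨hrank, -, -, hcompl⟩ := hbun q hq
    have : FiniteDimensional ℝ (Ep q) :=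
      Module.rank_lt_aleph0_iff.1 (hrank ▸ Cardinal.natCast_lt_aleph0)
    refine exists_time_norm_sub_le_of_notMem_cone hCsmul Φ.toFun DΦ q (fun t ht => ?_)
      (Ep q) (Fp q) hcompl (fun t ht v hv => ?_) (fun t ht v hv => ?_) (hcone q hq).1
      (P q) (hP q hq).1 (hP q hq).2.1 (hP q hq).2.2 (hab.trans_le (hb q hq)) hF
    · exact hasStrictFDerivAt_of_hasFDerivAt_of_continuousAt
        (Eventually.of_forall (hder t ht)) (hdercont t ht).continuousAt
    · have h1 := (hinv q hq t ht).1
      rw [hqE t ht] at h1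
      exact h1.le (Submodule.mem_map_of_mem hv)
    · have h1 := (hinv q hq t ht).2
      rw [hqE t ht] at h1
      exact h1 (Submodule.mem_map_of_mem hv))
  have hcontψ : ∀ y ∈ omegaSet Φ x, Continuous fun t : ℝ => ψ (-t) y := fun y hy =>
    hψcont.comp_continuous (f := fun t : ℝ => (-t, y)) (by fun_prop) fun _ => ⟨mem_univ _, hy⟩
  refine not_tendsto_zero_of_backward_steps (g := fun t => ‖ψ (-t) z - ψ (-t) zt‖)
    ((hcontψ z hz.1).sub (hcontψ zt hzt.1)).norm (fun t ht => ?_) hτ (T₁ := T₁) ?_ ?_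
  · refine norm_pos_iff.2 fun h0 => hun t ht ?_
    rwa [h0]
  · filter_upwards [htend.eventually hrange, eventually_ge_atTop T₁] with t ⟨T, h1, h2, h3⟩ ht
    refine ⟨T, h1, h2, ?_⟩
    simp only [hforward z hz.1 t T (hτ.le.trans h1), hforward zt hzt.1 t T (hτ.le.trans h1)] at h3
    exact h3 (hun _ (by linarith))
  · refine tendsto_order.2 ⟨fun ε hε => Eventually.of_forall fun t => hε.trans_le (norm_nonneg _),
      fun ε hε => ?_⟩
    have hopen : IsOpen {p : X × X | ‖p.1 - p.2‖ < ε} :=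
      isOpen_lt (by fun_prop) continuous_const
    refine htend (hopen.mem_nhdsSet.2 ?_)
    rintro _ ⟨q, -, rfl⟩
    simpa using hε
end
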